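/- arXiv:2005.02896 — 4 statements merged into one kernel-verified Lean document; each statement's English description precedes it below -/
import Mathlib

section
/- Let ε > 0 with 6ε ≤ 1, and let (G, w) be an ε-coherent weighted graph, where G is hole-with-hat-free. Then there exists Z ⊆ V(G) with |Z| > 1 such that G[Z] is connected and guarded, and w(Z) > 1 − 4ε. -/
open Finset

namespace EHhat

variable {V : Type*}

/-- `c : ZMod n → V` describes a hole (induced cycle of length `n ≥ 4`) in `G`. -/
def IsHole (G : SimpleGraph V) (n : ℕ) (c : ZMod n → V) : Prop :=
  4 ≤ n ∧ Function.Injective c ∧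
    ∀ i j : ZMod n, G.Adj (c i) (c j) ↔ (i - j = 1 ∨ j - i = 1)

/-- `G` contains a hole together with a hat: a vertex outside the hole with exactly
two neighbours on the hole, and these two neighbours are adjacent (consecutive). -/
def HasHoleWithHat (G : SimpleGraph V) : Prop :=
  ∃ (n : ℕ) (c : ZMod n → V) (v : V) (i : ZMod n),
    IsHole G n c ∧ (∀ j, v ≠ c j) ∧ (∀ j, G.Adj v (c j) ↔ (j = i ∨ j = i + 1))

def HoleWithHatFree (G : SimpleGraph V) : Prop := ¬ HasHoleWithHat G

/-- A graph is perfect if chromatic number equals clique number for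
every induced subgraph. -/
def IsPerfect [Fintype V] (G : SimpleGraph V) : Prop :=
  ∀ S : Finset V,
    (G.induce (S : Set V)).chromaticNumber = ((G.induce (S : Set V)).cliqueNum : ℕ∞)

/-- `f` is a good function on `G`: it is nonnegative and sums to at most 1 on
every perfect induced subgraph of `G`. -/
def GoodOn [Fintype V] (G : SimpleGraph V) (f : V → ℝ) : Prop :=
  (∀ v, 0 ≤ f v) ∧
  ∀ S : Finset V, IsPerfect (G.induce (S : Set V)) → ∑ v ∈ S, f v ≤ 1

/-- `G` is `α`-narrow if `∑ v, f v ^ α ≤ 1` for every good function `f` on `G`. -/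
def Narrow [Fintype V] (G : SimpleGraph V) (α : ℝ) : Prop :=
  ∀ f : V → ℝ, GoodOn G f → ∑ v, f v ^ α ≤ 1

/-- `(G, f)` is an `α`-critical pair. -/
def Critical [Fintype V] (G : SimpleGraph V) (f : V → ℝ) (α : ℝ) : Prop :=
  GoodOn G f ∧
  (∀ S : Finset V, S ≠ Finset.univ → Narrow (G.induce (S : Set V)) α) ∧
  1 < ∑ v, f v ^ α

/-- `A` is complete to `B`. -/
def CompleteTo (G : SimpleGraph V) (A B : Set V) : Prop :=
  ∀ a ∈ A, ∀ b ∈ B, G.Adj a b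

/-- `A` is anticomplete to `B`. -/
def AnticompleteTo (G : SimpleGraph V) (A B : Set V) : Prop :=
  ∀ a ∈ A, ∀ b ∈ B, ¬ G.Adj a b

/-- The vertex `v` is complete to the set `C`. -/
def VertCompleteTo (G : SimpleGraph V) (v : V) (C : Set V) : Prop :=
  ∀ c ∈ C, G.Adj v c

/-- The vertex `v` is mixed on `C`: it has both a neighbour and a non-neighbour in `C`. -/
def MixedOn (G : SimpleGraph V) (v : V) (C : Set V) : Prop :=
  (∃ c ∈ C, G.Adj v c) ∧ (∃ c ∈ C, ¬ G.Adj v c)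

/-- `X ⊆ V(G)` is connected: `G[X]` is a connected graph. -/
def ConnSet (G : SimpleGraph V) (X : Set V) : Prop :=
  (G.induce X).Connected

/-- `X ⊆ V(G)` is anticonnected: the complement of `G[X]` is a connected graph. -/
def AnticonnSet (G : SimpleGraph V) (X : Set V) : Prop :=
  ((G.induce X)ᶜ).Connected

/-- The sum of `f` over a set `X` of vertices. -/
noncomputable def setSum [Fintype V] (f : V → ℝ) (X : Set V) : ℝ :=
  ∑ v, X.indicator f v

/-- `w` is a weight function making `(G, w)` a weighted graph. -/
def IsWeight [Fintype V] (w : V → ℝ) : Prop :=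
  (∀ v, 0 ≤ w v) ∧ ∑ v, w v = 1

/-- The weighted graph `(G, w)` is `ε`-coherent. -/
def Coherent [Fintype V] (G : SimpleGraph V) (w : V → ℝ) (ε : ℝ) : Prop :=
  (∀ v, w v < ε) ∧
  (∀ v, setSum w (G.neighborSet v) < ε) ∧
  ∀ A B : Set V, Disjoint A B → AnticompleteTo G A B →
    min (setSum w A) (setSum w B) < ε

/-- `Y` is (the vertex set of) a component of `G[X]`: a maximal connected subset of `X`. -/
def IsCompOf (G : SimpleGraph V) (X Y : Set V) : Prop :=
  Y ⊆ X ∧ ConnSet G Y ∧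
  ∀ Z : Set V, Y ⊆ Z → Z ⊆ X → ConnSet G Z → Z = Y

/-- `Y` is the big component of `G[X]` (with respect to the weight `w` and `ε`). -/
def IsBigComp [Fintype V] (G : SimpleGraph V) (w : V → ℝ) (ε : ℝ) (X Y : Set V) : Prop :=
  IsCompOf G X Y ∧ setSum w X - ε < setSum w Y

/-- `v` is an attachment of `A`: a vertex outside `A` with a neighbour in `A`. -/
def IsAttachment (G : SimpleGraph V) (A : Set V) (v : V) : Prop :=
  v ∉ A ∧ ∃ a ∈ A, G.Adj v a

/-- `(C, D)` is a split of the weighted graph `(G, w)`. -/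
def IsSplit [Fintype V] (G : SimpleGraph V) (w : V → ℝ) (ε : ℝ) (C D : Set V) : Prop :=
  Disjoint C D ∧ 2 ≤ C.ncard ∧ ConnSet G C ∧ AnticonnSet G C ∧
  D.Nonempty ∧ D = {v | v ∉ C ∧ ∀ c ∈ C, G.Adj v c} ∧
  ∀ Y : Set V, IsBigComp G w ε ((C ∪ D)ᶜ) Y → ∀ c ∈ C, ¬ IsAttachment G Y c

/-- A split is optimal if its first part is maximal among splits. -/
def IsOptimalSplit [Fintype V] (G : SimpleGraph V) (w : V → ℝ) (ε : ℝ) (C D : Set V) : Prop :=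
  IsSplit G w ε C D ∧ ∀ C' D' : Set V, IsSplit G w ε C' D' → C ⊆ C' → C' = C

/-- `(A, C, D, B)` is a fracture of `(G, w)`: `(C, D)` is an optimal split, `A` is the union
of the components of `G \ (C ∪ D)` with an attachment in `C`, and `B` is the rest. -/
def IsFracture [Fintype V] (G : SimpleGraph V) (w : V → ℝ) (ε : ℝ)
    (A C D B : Set V) : Prop :=
  IsOptimalSplit G w ε C D ∧
  A = {v | ∃ Y : Set V, IsCompOf G ((C ∪ D)ᶜ) Y ∧ v ∈ Y ∧ ∃ c ∈ C, IsAttachment G Y c} ∧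
  B = ((C ∪ D)ᶜ : Set V) \ A

/-- The generating relation for the forcer graph: vertices `0,1,2,3` and `4,5,6,7`
each induce a path, and the two quadruples are complete to each other. -/
def forcerRel (i j : Fin 8) : Prop :=
  (i.val < 4 ∧ 4 ≤ j.val) ∨ j.val = i.val + 1

/-- The forcer graph. -/
def forcer : SimpleGraph (Fin 8) := SimpleGraph.fromRel forcerRel

def ForcerFree (G : SimpleGraph V) : Prop := IsEmpty (forcer ↪g G)

/-- Given an embedded copy of the forcer via the vertex map `f`, one of its two
constituent paths has all its vertices in `S`. -/
def ConstituentPathIn (f : Fin 8 → V) (S : Set V) : Prop :=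
  (∀ i : Fin 8, i.val < 4 → f i ∈ S) ∨ (∀ i : Fin 8, 4 ≤ i.val → f i ∈ S)

/-- `X` is a homogeneous set of `H`. -/
def IsHomogeneousSet {W : Type*} (H : SimpleGraph W) (X : Set W) : Prop :=
  ∀ v ∉ X, (∀ x ∈ X, H.Adj v x) ∨ (∀ x ∈ X, ¬ H.Adj v x)

/-- `H` is guarded: for each forcer in `H` there is a proper homogeneous set
containing a constituent path of the forcer. -/
def Guarded {W : Type*} (H : SimpleGraph W) : Prop :=
  ∀ f : forcer ↪g H, ∃ X : Set W,
    X ≠ Set.univ ∧ IsHomogeneousSet H X ∧ ConstituentPathIn (fun i => f i) X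

/-- The house: the complement of the five-vertex path. -/
def house : SimpleGraph (Fin 5) := (SimpleGraph.pathGraph 5)ᶜ

def HouseFree (G : SimpleGraph V) : Prop := IsEmpty (house ↪g G)

/-- `g` is a good function on the induced subgraph `G[X]`. -/
def GoodOnSub [Fintype V] (G : SimpleGraph V) (X : Set V) (g : V → ℝ) : Prop :=
  (∀ v ∈ X, 0 ≤ g v) ∧
  ∀ S : Finset V, (S : Set V) ⊆ X → IsPerfect (G.induce (S : Set V)) →
    ∑ v ∈ S, g v ≤ 1


/-! ### Connected and anticonnected sets -/

/-- A connected set has an edge across each of its nontrivial cuts. -/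
theorem ConnSet.exists_adj {G : SimpleGraph V} {X T : Set V} (h : ConnSet G X) {a b : V}
    (haX : a ∈ X) (haT : a ∈ T) (hbX : b ∈ X) (hbT : b ∉ T) :
    ∃ u ∈ X, u ∈ T ∧ ∃ v ∈ X, v ∉ T ∧ G.Adj u v := by
  obtain ⟨p⟩ := h.preconnected ⟨a, haX⟩ ⟨b, hbX⟩
  obtain ⟨d, -, hd₁, hd₂⟩ := p.exists_boundary_dart {x | x.1 ∈ T} haT hbT
  exact ⟨d.fst.1, d.fst.2, hd₁, d.snd.1, d.snd.2, hd₂, d.adj⟩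

theorem connSet_of_exists_adj {G : SimpleGraph V} {X : Set V} (hne : X.Nonempty)
    (h : ∀ T ⊆ X, T.Nonempty → T ≠ X → ∃ u ∈ T, ∃ v ∈ X, v ∉ T ∧ G.Adj u v) :
    ConnSet G X := by
  obtain ⟨a, ha⟩ := hne
  have key : ∀ b : X, (G.induce X).Reachable ⟨a, ha⟩ b := by
    by_contra! hcon
    obtain ⟨b, hb⟩ := hcon
    let T : Set V := {v | ∃ hv : v ∈ X, (G.induce X).Reachable ⟨a, ha⟩ ⟨v, hv⟩}
    have hT : T ⊆ X := fun v hv => hv.1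
    obtain ⟨u, ⟨huX, hu⟩, v, hvX, hvT, huv⟩ := h T hT ⟨a, ha, .rfl⟩ (by
      intro hTX
      have hbT : b.1 ∈ T := hTX.ge b.2
      exact hb hbT.2)
    refine hvT ⟨hvX, hu.trans (SimpleGraph.Adj.reachable ?_)⟩
    exact huv
  have : Nonempty X := ⟨⟨a, ha⟩⟩
  exact ⟨fun x y => (key x).symm.trans (key y)⟩

theorem ConnSet.nonempty {G : SimpleGraph V} {X : Set V} (h : ConnSet G X) : X.Nonempty :=
  Set.nonempty_coe_sort.1 (SimpleGraph.Connected.nonempty h)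

theorem connSet_singleton (G : SimpleGraph V) (a : V) : ConnSet G {a} :=
  connSet_of_exists_adj ⟨a, rfl⟩ fun _ hT hne hT' =>
    absurd ((Set.subset_singleton_iff_eq.1 hT).resolve_left hne.ne_empty) hT'

theorem ConnSet.union {G : SimpleGraph V} {X Y : Set V} (hX : ConnSet G X) (hY : ConnSet G Y)
    (h : ∃ x ∈ X, ∃ y ∈ Y, x = y ∨ G.Adj x y) : ConnSet G (X ∪ Y) := by
  obtain ⟨x, hx, y, hy, hxy⟩ := h
  refine connSet_of_exists_adj ⟨x, .inl hx⟩ fun T hT hne hTne => ?_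
  by_contra! hcon
  have allX : ∀ t ∈ X, t ∈ T → X ⊆ T := by
    intro t ht htT s hs
    by_contra hsT
    obtain ⟨u, -, huT, v, hv, hvT, huv⟩ := hX.exists_adj ht htT hs hsT
    exact hcon u huT v (.inl hv) hvT huv
  have allY : ∀ t ∈ Y, t ∈ T → Y ⊆ T := by
    intro t ht htT s hs
    by_contra hsT
    obtain ⟨u, -, huT, v, hv, hvT, huv⟩ := hY.exists_adj ht htT hs hsT
    exact hcon u huT v (.inr hv) hvT huv
  have hxT : x ∈ T ↔ y ∈ T := by
    rcases hxy with rfl | hxy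
    · rfl
    · exact ⟨fun h => by_contra fun h' => hcon x h y (.inr hy) h' hxy,
        fun h => by_contra fun h' => hcon y h x (.inl hx) h' hxy.symm⟩
  obtain ⟨t, ht⟩ := hne
  refine hTne (hT.antisymm (Set.union_subset ?_ ?_))
  · rcases hT ht with h | h
    · exact allX t h ht
    · exact allX x hx (hxT.2 (allY t h ht hy))
  · rcases hT ht with h | h
    · exact allY y hy (hxT.1 (allX t h ht hx))
    · exact allY t h ht

theorem ConnSet.insert {G : SimpleGraph V} {X : Set V} (hX : ConnSet G X) {v : V}
    (h : ∃ x ∈ X, v = x ∨ G.Adj v x) : ConnSet G (insert v X) := by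
  rw [Set.insert_eq]
  exact (connSet_singleton G v).union hX ⟨v, rfl, h⟩

theorem anticonnSet_iff {G : SimpleGraph V} {X : Set V} : AnticonnSet G X ↔ ConnSet Gᶜ X := by
  have : (G.induce X)ᶜ = Gᶜ.induce X := by
    ext a b
    simp [SimpleGraph.compl_adj, Subtype.ext_iff]
  rw [AnticonnSet, ConnSet, this]

theorem AnticonnSet.insert {G : SimpleGraph V} {X : Set V} (hX : AnticonnSet G X) {v : V}
    (h : ∃ x ∈ X, ¬ G.Adj v x) : AnticonnSet G (insert v X) := by
  rw [anticonnSet_iff] at hX ⊢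
  obtain ⟨x, hx, hvx⟩ := h
  refine hX.insert ⟨x, hx, ?_⟩
  by_cases hv : v = x
  · exact .inl hv
  · exact .inr ((SimpleGraph.compl_adj ..).2 ⟨hv, hvx⟩)

/-- A vertex mixed on a connected set distinguishes two adjacent vertices of it. -/
theorem ConnSet.exists_adj_of_mixedOn {G : SimpleGraph V} {X : Set V} (hX : ConnSet G X) {v : V}
    (hv : MixedOn G v X) : ∃ x ∈ X, ∃ y ∈ X, G.Adj x y ∧ G.Adj v x ∧ ¬ G.Adj v y := by
  obtain ⟨⟨a, ha, hva⟩, b, hb, hvb⟩ := hv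
  obtain ⟨x, hx, hvx, y, hy, hvy, hxy⟩ :=
    hX.exists_adj (T := {x | G.Adj v x}) ha hva hb hvb
  exact ⟨x, hx, y, hy, hxy, hvx, hvy⟩

/-- A vertex mixed on an anticonnected set distinguishes two nonadjacent vertices of it. -/
theorem AnticonnSet.exists_not_adj_of_mixedOn {G : SimpleGraph V} {X : Set V}
    (hX : AnticonnSet G X) {v : V} (hv : MixedOn G v X) :
    ∃ x ∈ X, ∃ y ∈ X, x ≠ y ∧ ¬ G.Adj x y ∧ G.Adj v x ∧ ¬ G.Adj v y := by
  obtain ⟨⟨a, ha, hva⟩, b, hb, hvb⟩ := hv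
  obtain ⟨x, hx, hvx, y, hy, hvy, hxy⟩ :=
    (anticonnSet_iff.1 hX).exists_adj (T := {x | G.Adj v x}) ha hva hb hvb
  rw [SimpleGraph.compl_adj] at hxy
  exact ⟨x, hx, y, hy, hxy.1, hxy.2, hvx, hvy⟩

/-- If every edge leaving `E` ends in `D`, a connected set meeting `E` and missing `D` lies in
`E`. -/
theorem ConnSet.subset_of_closed {G : SimpleGraph V} {S E D : Set V} (hS : ConnSet G S)
    (hE : ∀ e ∈ E, ∀ v, G.Adj e v → v ∈ E ∪ D) (hSD : Disjoint S D)
    (hSE : (S ∩ E).Nonempty) : S ⊆ E := by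
  intro s hs
  by_contra hsE
  obtain ⟨a, haS, haE⟩ := hSE
  obtain ⟨u, -, hu, v, hv, hvE, huv⟩ := hS.exists_adj haS haE hs hsE
  exact (hE u hu v huv).elim hvE (Set.disjoint_left.1 hSD hv)

/-- Every connected subset of `X` lies in a component of `G[X]`. -/
theorem exists_component [Finite V] {G : SimpleGraph V} {X S : Set V} (hS : ConnSet G S)
    (hSX : S ⊆ X) :
    ∃ E, S ⊆ E ∧ E ⊆ X ∧ ConnSet G E ∧ ∀ e ∈ E, ∀ v ∈ X, G.Adj e v → v ∈ E := by
  obtain ⟨E, hSE, hE⟩ := (Set.toFinite {E | E ⊆ X ∧ ConnSet G E}).exists_le_maximal ⟨hSX, hS⟩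
  refine ⟨E, hSE, hE.prop.1, hE.prop.2, fun e he v hv hev => ?_⟩
  exact hE.le_of_ge (y := insert v E)
    ⟨Set.insert_subset hv hE.prop.1, hE.prop.2.insert ⟨e, he, .inr hev.symm⟩⟩
    (Set.subset_insert v E) (Set.mem_insert v E)

theorem IsCompOf.mem_of_adj {G : SimpleGraph V} {X Y : Set V} (h : IsCompOf G X Y) {y v : V}
    (hy : y ∈ Y) (hv : v ∈ X) (hyv : G.Adj y v) : v ∈ Y := by
  have := h.2.2 (insert v Y) (Set.subset_insert v Y) (Set.insert_subset hv h.1)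
    (h.2.1.insert ⟨y, hy, .inr hyv.symm⟩)
  exact this ▸ Set.mem_insert v Y

/-! ### Holes with hats -/

/-- No vertex is mixed on both of two anticonnected sets that are complete to each other. -/
theorem HoleWithHatFree.not_mixedOn {G : SimpleGraph V} (hG : HoleWithHatFree G) {P Q : Set V}
    (hP : AnticonnSet G P) (hQ : AnticonnSet G Q) (hPQ : CompleteTo G P Q) {x : V}
    (hxP : MixedOn G x P) : ¬ MixedOn G x Q := by
  intro hxQ
  obtain ⟨p, hp, p', hp', hne, hpp, hxp, hxp'⟩ := hP.exists_not_adj_of_mixedOn hxP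
  obtain ⟨q, hq, q', hq', hne', hqq, hxq, hxq'⟩ := hQ.exists_not_adj_of_mixedOn hxQ
  have h1 := hPQ p hp q hq
  have h2 := hPQ p hp q' hq'
  have h3 := hPQ p' hp' q hq
  have h4 := hPQ p' hp' q' hq'
  have h5 : ¬ G.Adj p' p := fun h => hpp h.symm
  have h6 : ¬ G.Adj q' q := fun h => hqq h.symm
  refine hG ⟨4, (![p, q, p', q'] : Fin 4 → V), x, 0, ⟨le_rfl, ?_, ?_⟩, ?_, ?_⟩
  · change Function.Injective (![p, q, p', q'] : Fin 4 → V)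
    intro i j
    fin_cases i <;> fin_cases j <;>
      simp [hne, hne', hne.symm, hne'.symm, h1.ne, h2.ne, h3.ne, h4.ne, h1.ne', h2.ne', h3.ne',
        h4.ne']
  · change ∀ i j : Fin 4, G.Adj ((![p, q, p', q'] : Fin 4 → V) i)
      ((![p, q, p', q'] : Fin 4 → V) j) ↔ (i - j = 1 ∨ j - i = 1)
    intro i j
    fin_cases i <;> fin_cases j <;>
      simp [h1, h2, h3, h4, h5, h6, hpp, hqq, h1.symm, h2.symm, h3.symm, h4.symm] <;> decide
  · change ∀ j : Fin 4, x ≠ (![p, q, p', q'] : Fin 4 → V) j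
    intro j
    fin_cases j
    · exact hxp.ne
    · exact hxq.ne
    · rintro rfl
      exact hpp hxp.symm
    · rintro rfl
      exact hqq hxq.symm
  · change ∀ j : Fin 4, G.Adj x ((![p, q, p', q'] : Fin 4 → V) j) ↔ (j = 0 ∨ j = 0 + 1)
    intro j
    fin_cases j <;> simp [hxp, hxq, hxp', hxq']

/-- A hole with a hat from an edge-path of `G`: the path `s 0, …, s k` is induced, `x` sees only
its first vertex, `q` only its last, and `x'` is complete to `{x, q}` and misses the path. -/
theorem hasHoleWithHat_of_path {G : SimpleGraph V} {k : ℕ} (hk : 0 < k) {s : ℕ → V} {x x' q : V}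
    (hinj : ∀ i ≤ k, ∀ j ≤ k, s i = s j → i = j)
    (hadj : ∀ i ≤ k, ∀ j ≤ k, (G.Adj (s i) (s j) ↔ (i = j + 1 ∨ j = i + 1)))
    (hx : ∀ i ≤ k, (G.Adj x (s i) ↔ i = 0)) (hq : ∀ i ≤ k, (G.Adj q (s i) ↔ i = k))
    (hxs : ∀ i ≤ k, x ≠ s i) (hqs : ∀ i ≤ k, q ≠ s i)
    (hx's : ∀ i ≤ k, x' ≠ s i) (hx' : ∀ i ≤ k, ¬ G.Adj x' (s i))
    (hxq : G.Adj x q) (hx'q : G.Adj x' q) (hx'x : G.Adj x' x) : HasHoleWithHat G := by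
  let c : Fin (k + 3) → V := fun i =>
    if i.val = 0 then q else if i.val = 1 then x else s (i.val - 2)
  have key : ∀ i j : Fin (k + 3), (i - j = 1 ∨ j - i = 1) ↔
      (i.val = j.val + 1 ∨ j.val = i.val + 1 ∨ (i.val = 0 ∧ j.val = k + 2) ∨
        (j.val = 0 ∧ i.val = k + 2)) := by
    have key' : ∀ i j : Fin (k + 3), i - j = 1 ↔
        (i.val = j.val + 1 ∨ (i.val = 0 ∧ j.val = k + 2)) := by
      intro i j
      rw [sub_eq_iff_eq_add, Fin.ext_iff, Fin.val_add]
      have h1 : ((1 : Fin (k + 3)) : ℕ) = 1 := by simp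
      have hi := i.2
      have hj := j.2
      rw [h1]
      by_cases h : j.val = k + 2
      · rw [h, show 1 + (k + 2) = k + 3 by omega, Nat.mod_self]
        omega
      · rw [Nat.mod_eq_of_lt (by omega)]
        omega
    intro i j
    rw [key', key']
    tauto
  refine ⟨k + 3, c, x', (0 : Fin (k + 3)), ⟨by omega, ?_, ?_⟩, ?_, ?_⟩
  · change Function.Injective c
    intro i j hij
    have hi := i.2
    have hj := j.2
    simp only [c] at hij
    apply Fin.ext
    split_ifs at hij with h1 h2 h3 h4 h5 h6 h7 h8
    · omega
    · exact absurd hij hxq.ne'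
    · exact absurd hij (hqs _ (by omega))
    · exact absurd hij hxq.ne
    · omega
    · exact absurd hij (hxs _ (by omega))
    · exact absurd hij.symm (hqs _ (by omega))
    · exact absurd hij.symm (hxs _ (by omega))
    · have := hinj _ (by omega) _ (by omega) hij
      omega
  · change ∀ i j : Fin (k + 3), G.Adj (c i) (c j) ↔ (i - j = 1 ∨ j - i = 1)
    intro i j
    have hi := i.2
    have hj := j.2
    rw [key]
    simp only [c]
    split_ifs with h1 h2 h3 h4 h5 h6 h7 h8
    · simp only [SimpleGraph.irrefl, false_iff]
      omega
    · simp only [hxq.symm, true_iff]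
      omega
    · rw [hq _ (by omega)]
      omega
    · simp only [hxq, true_iff]
      omega
    · simp only [SimpleGraph.irrefl, false_iff]
      omega
    · rw [hx _ (by omega)]
      omega
    · rw [G.adj_comm, hq _ (by omega)]
      omega
    · rw [G.adj_comm, hx _ (by omega)]
      omega
    · rw [hadj _ (by omega) _ (by omega)]
      omega
  · change ∀ j : Fin (k + 3), x' ≠ c j
    intro j
    have hj := j.2
    simp only [c]
    split_ifs with h1 h2
    · exact hx'q.ne
    · exact hx'x.ne
    · exact hx's _ (by omega)
  · change ∀ j : Fin (k + 3), G.Adj x' (c j) ↔ (j = 0 ∨ j = 0 + 1)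
    intro j
    have hj := j.2
    have e : (j = 0 ∨ j = 0 + 1) ↔ (j.val = 0 ∨ j.val = 1) := by
      rw [zero_add, Fin.ext_iff, Fin.ext_iff]
      simp
    rw [e]
    simp only [c]
    split_ifs with h1 h2
    · simp [hx'q, h1]
    · simp [hx'x, h2]
    · simp [hx' _ (show j.val - 2 ≤ k by omega), h1, h2]

/-- A shortest path in a connected set `S` from a set `A` to a set `B`. -/
theorem ConnSet.exists_induced_path {G : SimpleGraph V} {S A B : Set V} (hS : ConnSet G S)
    (hA : (S ∩ A).Nonempty) (hB : (S ∩ B).Nonempty) :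
    ∃ (k : ℕ) (s : ℕ → V), (∀ i ≤ k, s i ∈ S) ∧ (∀ i ≤ k, (s i ∈ A ↔ i = 0)) ∧
      (∀ i ≤ k, (s i ∈ B ↔ i = k)) ∧ (∀ i ≤ k, ∀ j ≤ k, s i = s j → i = j) ∧
      ∀ i ≤ k, ∀ j ≤ k, (G.Adj (s i) (s j) ↔ (i = j + 1 ∨ j = i + 1)) := by
  classical
  let p : ℕ → Prop := fun k => ∃ s : ℕ → V, (∀ i ≤ k, s i ∈ S) ∧ s 0 ∈ A ∧ s k ∈ B ∧
    ∀ i < k, G.Adj (s i) (s (i + 1))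
  have hp : ∃ k, p k := by
    obtain ⟨a, haS, haA⟩ := hA
    obtain ⟨b, hbS, hbB⟩ := hB
    obtain ⟨W⟩ := hS.preconnected ⟨a, haS⟩ ⟨b, hbS⟩
    refine ⟨W.length, fun i => (W.getVert i).1, fun i _ => (W.getVert i).2, ?_, ?_, ?_⟩
    · simpa using haA
    · simpa using hbB
    · intro i hi
      exact W.adj_getVert_succ hi
  obtain ⟨s, hsS, hsA, hsB, hs⟩ := Nat.find_spec hp
  have hmin : ∀ m, m < Nat.find hp → ¬ p m := fun m => Nat.find_min hp
  generalize Nat.find hp = k at *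
  have shortcut : ∀ i j, i + 1 < j → j ≤ k → ¬ G.Adj (s i) (s j) := by
    intro i j hij hjk hadj
    refine hmin (k - (j - i - 1)) (by omega)
      ⟨fun t => if t ≤ i then s t else s (t + (j - i - 1)), ?_, ?_, ?_, ?_⟩
    · intro t ht
      dsimp only
      split_ifs <;> exact hsS _ (by omega)
    · simpa using hsA
    · dsimp only
      rw [if_neg (by omega), show k - (j - i - 1) + (j - i - 1) = k by omega]
      exact hsB
    · intro t ht
      dsimp only
      rcases lt_trichotomy t i with h | h | h
      · rw [if_pos (by omega), if_pos (by omega)]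
        exact hs t (by omega)
      · rw [if_pos (by omega), if_neg (by omega), show t + 1 + (j - i - 1) = j by omega, h]
        exact hadj
      · rw [if_neg (by omega), if_neg (by omega),
          show t + 1 + (j - i - 1) = t + (j - i - 1) + 1 by omega]
        exact hs _ (by omega)
  have endB : ∀ i ≤ k, (s i ∈ B ↔ i = k) := by
    refine fun i hi => ⟨fun h => ?_, fun h => h ▸ hsB⟩
    by_contra hne
    exact hmin i (by omega) ⟨s, fun t ht => hsS t (by omega), hsA, h, fun t ht => hs t (by omega)⟩
  have ne_of_lt : ∀ i j, i < j → j ≤ k → s i ≠ s j := by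
    intro i j hij hjk heq
    rcases hjk.eq_or_lt with rfl | hlt
    · have := (endB i hij.le).1 (heq ▸ hsB)
      omega
    · exact shortcut i (j + 1) (by omega) hlt (heq ▸ hs j hlt)
  refine ⟨k, s, hsS, ?_, endB, ?_, ?_⟩
  · refine fun i hi => ⟨fun h => ?_, fun h => h ▸ hsA⟩
    by_contra hne
    refine hmin (k - i) (by omega) ⟨fun t => s (t + i), fun t ht => hsS _ (by omega), ?_, ?_, ?_⟩
    · simpa using h
    · dsimp only
      rwa [show k - i + i = k by omega]
    · intro t ht
      have := hs (t + i) (by omega)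
      rwa [show t + i + 1 = t + 1 + i by omega] at this
  · intro i hi j hj h
    by_contra hne
    rcases lt_or_gt_of_ne hne with hlt | hlt
    · exact ne_of_lt i j hlt hj h
    · exact ne_of_lt j i hlt hi h.symm
  · intro i hi j hj
    constructor
    · intro h
      by_contra hne
      rcases lt_trichotomy i j with hlt | heq | hlt
      · exact shortcut i j (by omega) hj h
      · exact h.ne (by rw [heq])
      · exact shortcut j i (by omega) hi h.symm
    · rintro (rfl | rfl)
      · exact (hs j (by omega)).symm
      · exact hs i (by omega)

/-- Let `P` be connected and complete to `q`, and let `S` be connected, with attachments in `P`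
and at `q`. Some vertex of `S` with a neighbour in `P` is complete to `P` or adjacent to `q`. -/
theorem HoleWithHatFree.exists_attached {G : SimpleGraph V} (hG : HoleWithHatFree G)
    {P S : Set V} {q : V} (hP : ConnSet G P) (hS : ConnSet G S) (hPq : ∀ p ∈ P, G.Adj p q)
    (hPS : Disjoint P S) (hqS : q ∉ S) (hSP : ∃ s ∈ S, ∃ p ∈ P, G.Adj s p)
    (hSq : ∃ s ∈ S, G.Adj s q) :
    ∃ s ∈ S, (∃ p ∈ P, G.Adj s p) ∧ ((∀ p ∈ P, G.Adj s p) ∨ G.Adj s q) := by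
  by_contra! hcon
  obtain ⟨s₀, hs₀, hs₀'⟩ := hSP
  obtain ⟨s₁, hs₁, hs₁'⟩ := hSq
  obtain ⟨k, s, hsS, hsA, hsB, hinj, hadj⟩ := hS.exists_induced_path
    (A := {v | ∃ p ∈ P, G.Adj v p}) (B := {v | G.Adj v q}) ⟨s₀, hs₀, hs₀'⟩ ⟨s₁, hs₁, hs₁'⟩
  have h0 : ∃ p ∈ P, G.Adj (s 0) p := (hsA 0 (Nat.zero_le k)).2 rfl
  have hk : 0 < k := by
    refine Nat.pos_of_ne_zero fun hk => ?_
    exact (hcon (s 0) (hsS 0 (Nat.zero_le k)) h0).2 ((hsB 0 (Nat.zero_le k)).2 hk.symm)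
  obtain ⟨x, hx, x', hx', hxx', hsx, hsx'⟩ :=
    hP.exists_adj_of_mixedOn ⟨h0, (hcon (s 0) (hsS 0 (Nat.zero_le k)) h0).1⟩
  have miss : ∀ p ∈ P, ∀ i ≤ k, p ≠ s i := fun p hp i hi h =>
    Set.disjoint_left.1 hPS hp (h ▸ hsS i hi)
  refine hG (hasHoleWithHat_of_path hk (x := x) (x' := x') (q := q) hinj hadj ?_ ?_ (miss x hx) ?_
    (miss x' hx') ?_ (hPq x hx) (hPq x' hx') hxx'.symm)
  · refine fun i hi => ⟨fun h => (hsA i hi).1 ⟨x, hx, h.symm⟩, ?_⟩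
    rintro rfl
    exact hsx.symm
  · exact fun i hi => (G.adj_comm _ _).trans (hsB i hi)
  · exact fun i hi h => hqS (h ▸ hsS i hi)
  · intro i hi h
    obtain rfl := (hsA i hi).1 ⟨x', hx', h.symm⟩
    exact hsx' h.symm

/-! ### Complete pairs -/

/-- The vertices outside `C` that are complete to `C`. -/
def commonNbrs (G : SimpleGraph V) (C : Set V) : Set V :=
  {v | v ∉ C ∧ ∀ c ∈ C, G.Adj v c}

theorem CompleteTo.subset_commonNbrs {G : SimpleGraph V} {P Q : Set V} (h : CompleteTo G P Q) :
    Q ⊆ commonNbrs G P :=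
  fun q hq => ⟨fun hqP => (h q hqP q hq).ne rfl, fun p hp => (h p hp q hq).symm⟩

theorem CompleteTo.symm {G : SimpleGraph V} {P Q : Set V} (h : CompleteTo G P Q) : CompleteTo G Q P :=
  fun q hq p hp => (h p hp q hq).symm

/-- `P` and `Q` are connected and anticonnected, have at least two vertices each, and are complete
to each other. -/
structure IsCompletePair (G : SimpleGraph V) (P Q : Set V) : Prop where
  left_card : 2 ≤ P.ncard
  right_card : 2 ≤ Q.ncard
  left_conn : ConnSet G P
  right_conn : ConnSet G Q
  left_anticonn : AnticonnSet G P
  right_anticonn : AnticonnSet G Q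
  complete : CompleteTo G P Q

theorem IsCompletePair.symm {G : SimpleGraph V} {P Q : Set V} (h : IsCompletePair G P Q) : IsCompletePair G Q P :=
  ⟨h.2, h.1, h.4, h.3, h.6, h.5, h.7.symm⟩

theorem IsCompletePair.right_nonempty {G : SimpleGraph V} {P Q : Set V} (h : IsCompletePair G P Q) :
    (commonNbrs G P).Nonempty :=
  h.right_conn.nonempty.mono h.complete.subset_commonNbrs

/-- In a maximal complete pair `(P, Q)`, a component outside of `P` and its common neighbours with
an attachment in `P` misses `Q` and has no attachment in it. -/
theorem IsCompletePair.not_adj_of_maximal [Finite V] {G : SimpleGraph V} (hG : HoleWithHatFree G) {P Q : Set V}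
    (h : IsCompletePair G P Q)
    (hmax : ∀ P', P ⊆ P' → IsCompletePair G P' Q → P' = P) {Y : Set V}
    (hY : IsCompOf G (P ∪ commonNbrs G P)ᶜ Y) (hYP : ∃ c ∈ P, ∃ y ∈ Y, G.Adj c y) :
    ∀ y ∈ Y, ∀ q ∈ Q, ¬ G.Adj y q := by
  have hYd : ∀ y ∈ Y, y ∉ P ∧ y ∉ commonNbrs G P := fun y hy =>
    ⟨fun h => hY.1 hy (.inl h), fun h => hY.1 hy (.inr h)⟩
  have hmix : ∀ y ∈ Y, (∃ p ∈ P, G.Adj y p) → MixedOn G y P := by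
    refine fun y hy hyp => ⟨hyp, ?_⟩
    by_contra! hcon
    exact (hYd y hy).2 ⟨(hYd y hy).1, hcon⟩
  have key : ∀ y ∈ Y, (∃ p ∈ P, G.Adj y p) → ∀ q ∈ Q, ¬ G.Adj y q := by
    intro y hy hyp q hq hyq
    have hm := hmix y hy hyp
    have hyQ : CompleteTo G (insert y P) Q := by
      rintro p (rfl | hp) q' hq'
      · by_contra hpq
        exact hG.not_mixedOn h.left_anticonn h.right_anticonn h.complete hm
          ⟨⟨q, hq, hyq⟩, q', hq', hpq⟩
      · exact h.complete p hp q' hq'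
    have := hmax (insert y P) (Set.subset_insert y P)
      { h with
        left_card := h.left_card.trans (Set.ncard_le_ncard (Set.subset_insert y P))
        left_conn := h.left_conn.insert (hm.1.imp fun p hp => ⟨hp.1, .inr hp.2⟩)
        left_anticonn := h.left_anticonn.insert hm.2
        complete := hyQ }
    exact (hYd y hy).1 (this ▸ Set.mem_insert y P)
  intro y hy q hq hyq
  obtain ⟨c, hc, s, hs, hcs⟩ := hYP
  obtain ⟨s, hs, hsP, hs'⟩ := hG.exists_attached (q := q) h.left_conn hY.2.1
    (fun p hp => h.complete p hp q hq) (Set.disjoint_left.2 fun p hp hpY => (hYd p hpY).1 hp)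
    (fun hqY => (hYd q hqY).2 (h.complete.subset_commonNbrs hq)) ⟨s, hs, c, hc, hcs.symm⟩
    ⟨y, hy, hyq⟩
  rcases hs' with hs' | hs'
  · exact (hYd s hs).2 ⟨(hYd s hs).1, hs'⟩
  · exact key s hs hsP q hq hs'

/-! ### Weights -/

section Weight

variable [Fintype V] {G : SimpleGraph V} {w : V → ℝ} {ε : ℝ}

theorem IsWeight.setSum_mono (hw : IsWeight w) {X Y : Set V} (h : X ⊆ Y) :
    setSum w X ≤ setSum w Y :=
  Finset.sum_le_sum fun v _ => Set.indicator_le_indicator_of_subset h hw.1 v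

theorem setSum_union (w : V → ℝ) {X Y : Set V} (h : Disjoint X Y) :
    setSum w (X ∪ Y) = setSum w X + setSum w Y := by
  simp only [setSum, ← Finset.sum_add_distrib, Set.indicator_union_of_disjoint h]

theorem IsWeight.setSum_univ (hw : IsWeight w) : setSum w Set.univ = 1 := by
  simpa [setSum] using hw.2

theorem IsWeight.setSum_compl (hw : IsWeight w) (X : Set V) :
    setSum w Xᶜ = 1 - setSum w X := by
  have := setSum_union w (disjoint_compl_right (a := X))
  rw [Set.union_compl_self, hw.setSum_univ] at this
  linarith

theorem IsWeight.setSum_union_le (hw : IsWeight w) (X Y : Set V) :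
    setSum w (X ∪ Y) ≤ setSum w X + setSum w Y := by
  rw [← Set.union_sdiff_self, setSum_union w Set.disjoint_sdiff_right]
  have := hw.setSum_mono (Set.sdiff_subset : Y \ X ⊆ Y)
  linarith

theorem setSum_empty (w : V → ℝ) : setSum w ∅ = 0 := by
  simp [setSum]

theorem setSum_singleton (w : V → ℝ) (v : V) : setSum w {v} = w v := by
  classical
  simp [setSum, Set.indicator_apply]

theorem IsWeight.inter_nonempty (hw : IsWeight w) {X Y : Set V}
    (h : 1 < setSum w X + setSum w Y) : (X ∩ Y).Nonempty := by
  by_contra hne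
  have hd : Disjoint X Y := Set.disjoint_iff_inter_eq_empty.2 (Set.not_nonempty_iff_eq_empty.1 hne)
  have h1 := setSum_union w hd
  have h2 := hw.setSum_mono (Set.subset_univ (X ∪ Y))
  rw [hw.setSum_univ] at h2
  linarith

theorem Coherent.setSum_lt_of_subset_neighborSet (hcoh : Coherent G w ε) (hw : IsWeight w)
    {X : Set V} {v : V} (h : ∀ x ∈ X, G.Adj v x) : setSum w X < ε :=
  (hw.setSum_mono (Y := G.neighborSet v) h).trans_lt (hcoh.2.1 v)

/-- In a coherent graph each set that is not too light induces a big component. -/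
theorem Coherent.exists_isBigComp (hcoh : Coherent G w ε) (hε : 0 < ε)
    {X : Set V} (hX : 3 * ε ≤ setSum w X) : ∃ Y, IsBigComp G w ε X Y := by
  let p : Set V → Prop := fun T => T ⊆ X ∧ (∀ t ∈ T, ∀ v ∈ X, G.Adj t v → v ∈ T) ∧
    setSum w X - ε < setSum w T
  obtain ⟨Y, hY⟩ := (Set.toFinite {T | p T}).exists_minimal
    ⟨X, subset_rfl, fun _ _ v hv _ => hv, by linarith⟩
  obtain ⟨hYX, hYcl, hYw⟩ := hY.prop
  have light : ∀ T, T ⊆ Y → T ≠ Y → (∀ t ∈ T, ∀ v ∈ X, G.Adj t v → v ∈ T) → setSum w T < ε := by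
    intro T hTY hne hT
    have h1 : setSum w T ≤ setSum w X - ε := by
      by_contra! hlt
      exact hne (hTY.antisymm (hY.le_of_le (y := T) ⟨hTY.trans hYX, hT, hlt⟩ hTY))
    have h2 := setSum_union w (Set.disjoint_sdiff_right (s := T) (t := X))
    rw [Set.union_sdiff_cancel (hTY.trans hYX)] at h2
    have h3 := hcoh.2.2 T (X \ T) Set.disjoint_sdiff_right
      fun t ht v hv htv => hv.2 (hT t ht v hv.1 htv)
    rcases min_lt_iff.1 h3 with h | h
    · exact h
    · linarith
  have hconn : ConnSet G Y := by
    refine connSet_of_exists_adj ?_ fun T hTY hne hTne => ?_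
    · by_contra hne
      rw [Set.not_nonempty_iff_eq_empty] at hne
      rw [hne, setSum_empty] at hYw
      linarith
    · by_contra! hcon
      have h1 := light T hTY hTne fun t ht v hv htv => by_contra fun hvT =>
        hcon t ht v (hYcl t (hTY ht) v hv htv) hvT htv
      have h2 := light (Y \ T) Set.sdiff_subset
        (fun h => by
          obtain ⟨t, ht⟩ := hne
          exact (h.ge (hTY ht)).2 ht)
        fun t ht v hv htv => ⟨hYcl t ht.1 v hv htv, fun hvT => hcon v hvT t ht.1 ht.2 htv.symm⟩
      have h3 := setSum_union w (Set.disjoint_sdiff_right (s := T) (t := Y))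
      rw [Set.union_sdiff_cancel hTY] at h3
      linarith
  refine ⟨Y, ⟨hYX, hconn, fun Z hYZ hZX hZ => ?_⟩, hYw⟩
  refine Set.Subset.antisymm (fun z hz => ?_) hYZ
  obtain ⟨y, hy⟩ := hconn.nonempty
  by_contra hzY
  obtain ⟨u, -, huY, v, hv, hvY, huv⟩ := hZ.exists_adj (hYZ hy) hy hz hzY
  exact hvY (hYcl u huY v (hZX hv) huv)

/-! ### Splits -/

theorem setSum_union_commonNbrs_lt (hcoh : Coherent G w ε) (hw : IsWeight w) {C : Set V}
    (hC : C.Nonempty) (hD : (commonNbrs G C).Nonempty) :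
    setSum w (C ∪ commonNbrs G C) < 2 * ε := by
  obtain ⟨c, hc⟩ := hC
  obtain ⟨d, hd⟩ := hD
  have h1 := hcoh.setSum_lt_of_subset_neighborSet hw (X := C) (v := d) hd.2
  have h2 := hcoh.setSum_lt_of_subset_neighborSet hw (X := commonNbrs G C) (v := c)
    fun x hx => (hx.2 c hc).symm
  have := hw.setSum_union_le C (commonNbrs G C)
  linarith

/-- The complement of `C ∪ commonNbrs G C` has a big component, which is heavy. -/
theorem exists_isBigComp_compl (hcoh : Coherent G w ε) (hw : IsWeight w) (hε : 0 < ε)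
    (h6 : 6 * ε ≤ 1) {C : Set V} (hC : C.Nonempty) (hD : (commonNbrs G C).Nonempty) :
    (∃ Y, IsBigComp G w ε (C ∪ commonNbrs G C)ᶜ Y) ∧
      ∀ Y, IsBigComp G w ε (C ∪ commonNbrs G C)ᶜ Y → 1 - 3 * ε < setSum w Y := by
  have h := setSum_union_commonNbrs_lt hcoh hw hC hD
  have h' := hw.setSum_compl (C ∪ commonNbrs G C)
  refine ⟨hcoh.exists_isBigComp hε (by linarith), fun Y hY => ?_⟩
  have := hY.2
  linarith

/-- If `(C, commonNbrs G C)` is not a split, then its big component has an attachment in `C`. -/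
theorem exists_bigComp_of_not_isSplit {C : Set V} (h2 : 2 ≤ C.ncard) (hC : ConnSet G C)
    (hC' : AnticonnSet G C) (hD : (commonNbrs G C).Nonempty)
    (h : ¬ IsSplit G w ε C (commonNbrs G C)) :
    ∃ Y, IsBigComp G w ε (C ∪ commonNbrs G C)ᶜ Y ∧ ∃ c ∈ C, ∃ y ∈ Y, G.Adj c y := by
  by_contra! hcon
  refine h ⟨Set.disjoint_left.2 fun v hv hv' => hv'.1 hv, h2, hC, hC', hD, rfl, ?_⟩
  rintro Y hY c hc ⟨-, y, hy, hcy⟩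
  exact hcon Y hY c hc y hy hcy

/-- In an `ε`-coherent graph one side of each complete pair extends to a split. -/
theorem IsCompletePair.exists_isSplit (hcoh : Coherent G w ε) (hw : IsWeight w) (hε : 0 < ε)
    (h6 : 6 * ε ≤ 1) (hG : HoleWithHatFree G) {P Q : Set V} (h : IsCompletePair G P Q) :
    ∃ C, IsSplit G w ε C (commonNbrs G C) ∧ (P ⊆ C ∨ Q ⊆ C) := by
  obtain ⟨⟨C, D⟩, hle, hmax⟩ :=
    (Set.toFinite {p : Set V × Set V | IsCompletePair G p.1 p.2}).exists_le_maximal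
      (a := (P, Q)) h
  have hCD : IsCompletePair G C D := hmax.prop
  by_contra! hcon
  obtain ⟨Y, hY, hYC⟩ := exists_bigComp_of_not_isSplit hCD.left_card hCD.left_conn
    hCD.left_anticonn hCD.right_nonempty fun hs => (hcon C hs).1 hle.1
  obtain ⟨Y', hY', hYD⟩ := exists_bigComp_of_not_isSplit hCD.right_card hCD.right_conn
    hCD.right_anticonn hCD.symm.right_nonempty fun hs => (hcon D hs).2 hle.2
  have hn := hCD.not_adj_of_maximal hG (fun P' hP h' =>
    (hmax.le_of_ge (y := (P', D)) h' ⟨hP, le_rfl⟩).1.antisymm hP) hY.1 hYC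
  have hn' := hCD.symm.not_adj_of_maximal hG (fun P' hP h' =>
    (hmax.le_of_ge (y := (C, P')) h'.symm ⟨le_rfl, hP⟩).2.antisymm hP) hY'.1 hYD
  have hYw := (exists_isBigComp_compl hcoh hw hε h6 hCD.left_conn.nonempty
    hCD.right_nonempty).2 Y hY
  have hYw' := (exists_isBigComp_compl hcoh hw hε h6 hCD.right_conn.nonempty
    hCD.symm.right_nonempty).2 Y' hY'
  obtain ⟨z, hzY, hzY'⟩ := hw.inter_nonempty (X := Y) (Y := Y') (by linarith)
  obtain ⟨d, hd, y, hy, hdy⟩ := hYD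
  obtain ⟨u, -, huY, v, hv, hvY, huv⟩ := hY'.1.2.1.exists_adj hzY' hzY hy
    fun hyY => hn y hyY d hd hdy.symm
  have hvX : v ∈ C ∪ commonNbrs G C := by
    by_contra hvX
    exact hvY (hY.1.mem_of_adj huY hvX huv)
  rcases hvX with hvC | hvD
  · exact hY'.1.1 hv (.inr (hCD.complete.symm.subset_commonNbrs hvC))
  · obtain ⟨c, hc⟩ := hCD.left_conn.nonempty
    exact hn' v hv c hc (hvD.2 c hc)

/-! ### Blocks -/

/-- `C` is the first part of an optimal split, `E` is the component containing `C` of the graph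
obtained by deleting the common neighbours of `C`, and `Y` is a heavy component of that graph. -/
structure IsBlock (G : SimpleGraph V) (w : V → ℝ) (ε : ℝ) (C E Y : Set V) : Prop where
  optimal : IsOptimalSplit G w ε C (commonNbrs G C)
  subset : C ⊆ E
  conn : ConnSet G E
  disjoint : Disjoint E (commonNbrs G C)
  closed : ∀ e ∈ E, ∀ v, G.Adj e v → v ∈ E ∪ commonNbrs G C
  heavy_conn : ConnSet G Y
  heavy_disjoint : Disjoint Y (commonNbrs G C)
  heavy_closed : ∀ y ∈ Y, ∀ v, G.Adj y v → v ∈ Y ∪ commonNbrs G C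
  disjoint_heavy : Disjoint E Y
  heavy : 1 - 3 * ε < setSum w Y

theorem IsOptimalSplit.exists_isBlock (hcoh : Coherent G w ε) (hw : IsWeight w) (hε : 0 < ε)
    (h6 : 6 * ε ≤ 1) {C : Set V} (h : IsOptimalSplit G w ε C (commonNbrs G C)) :
    ∃ E Y, IsBlock G w ε C E Y := by
  obtain ⟨hCD, -, hC, -, hD, -, hatt⟩ := h.1
  obtain ⟨E, hCE, hED, hE, hEcl⟩ := exists_component hC (X := (commonNbrs G C)ᶜ)
    (Set.subset_compl_iff_disjoint_right.2 hCD)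
  obtain ⟨⟨Y, hY⟩, hYw⟩ := exists_isBigComp_compl hcoh hw hε h6 hC.nonempty hD
  have hYC : ∀ y ∈ Y, y ∉ C := fun y hy hyC => hY.1.1 hy (.inl hyC)
  have hYcl : ∀ y ∈ Y, ∀ v, G.Adj y v → v ∈ Y ∪ commonNbrs G C := by
    intro y hy v hyv
    by_contra hv
    rw [Set.mem_union, not_or] at hv
    by_cases hvC : v ∈ C
    · exact hatt Y hY v hvC ⟨hv.1, y, hy, hyv.symm⟩
    · exact hv.1 (hY.1.mem_of_adj hy (fun h => h.elim hvC hv.2) hyv)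
  have hED' : Disjoint E (commonNbrs G C) := Set.subset_compl_iff_disjoint_right.1 hED
  refine ⟨E, Y, h, hCE, hE, hED', fun e he v hev => ?_, hY.1.2.1,
    Set.disjoint_left.2 fun y hy hyD => hY.1.1 hy (.inr hyD), hYcl, ?_, hYw Y hY⟩
  · by_cases hv : v ∈ commonNbrs G C
    · exact .inr hv
    · exact .inl (hEcl e he v hv hev)
  · rw [Set.disjoint_iff_inter_eq_empty, ← Set.not_nonempty_iff_eq_empty]
    intro hne
    obtain ⟨c, hc⟩ := hC.nonempty
    exact hYC c (hE.subset_of_closed hYcl hED' hne (hCE hc)) hc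

namespace IsBlock

variable {C₁ E₁ Y₁ C₂ E₂ Y₂ C₃ E₃ Y₃ : Set V}

theorem nonempty (h : IsBlock G w ε C₁ E₁ Y₁) : C₁.Nonempty := h.optimal.1.2.2.1.nonempty

theorem anticonn (h : IsBlock G w ε C₁ E₁ Y₁) : AnticonnSet G C₁ := h.optimal.1.2.2.2.1

theorem heavy_subset (hw : IsWeight w) (h6 : 6 * ε ≤ 1) (h₁ : IsBlock G w ε C₁ E₁ Y₁)
    (h₂ : IsBlock G w ε C₂ E₂ Y₂) (h : (C₁ ∩ E₂).Nonempty) : Y₂ ⊆ Y₁ := by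
  obtain ⟨x, hx₁, hx₂⟩ := h
  refine h₂.heavy_conn.subset_of_closed h₁.heavy_closed
    (Set.disjoint_left.2 fun d hdY hd => ?_) (hw.inter_nonempty ?_)
  · rcases h₂.closed x hx₂ d (hd.2 x hx₁).symm with h | h
    · exact Set.disjoint_left.1 h₂.disjoint_heavy h hdY
    · exact Set.disjoint_left.1 h₂.heavy_disjoint hdY h
  · linarith [h₁.heavy, h₂.heavy]

theorem subset_commonNbrs_of_inter (h₁ : IsBlock G w ε C₁ E₁ Y₁)
    (h : ¬ (C₂ ∩ E₁).Nonempty) (hx : (E₁ ∩ commonNbrs G C₂).Nonempty) :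
    C₂ ⊆ commonNbrs G C₁ ∧ C₁ ⊆ commonNbrs G C₂ := by
  obtain ⟨x, hx₁, hx₂⟩ := hx
  have h₂₁ : C₂ ⊆ commonNbrs G C₁ := fun c hc =>
    (h₁.closed x hx₁ c (hx₂.2 c hc)).resolve_left fun hcE => h ⟨c, hc, hcE⟩
  exact ⟨h₂₁, CompleteTo.subset_commonNbrs fun c₂ hc₂ c₁ hc₁ => (h₂₁ hc₂).2 c₁ hc₁⟩

theorem subset_commonNbrs_of_touching (h₁ : IsBlock G w ε C₁ E₁ Y₁)
    (h₂ : IsBlock G w ε C₂ E₂ Y₂) (n₁ : ¬ (C₁ ∩ E₂).Nonempty) (n₂ : ¬ (C₂ ∩ E₁).Nonempty)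
    {u v : V} (hu : u ∈ E₁) (hv : v ∈ E₂) (huv : u = v ∨ G.Adj u v) :
    C₂ ⊆ commonNbrs G C₁ ∧ C₁ ⊆ commonNbrs G C₂ := by
  refine h₁.subset_commonNbrs_of_inter n₂ ?_
  by_contra hne
  have hd : Disjoint E₁ (commonNbrs G C₂) :=
    Set.disjoint_iff_inter_eq_empty.2 (Set.not_nonempty_iff_eq_empty.1 hne)
  have huE : u ∈ E₂ := by
    rcases huv with rfl | huv
    · exact hv
    · exact (h₂.closed v hv u huv.symm).resolve_right (Set.disjoint_left.1 hd hu)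
  obtain ⟨c, hc⟩ := h₁.nonempty
  exact n₁ ⟨c, hc, h₁.conn.subset_of_closed h₂.closed hd ⟨u, hu, huE⟩ (h₁.subset hc)⟩

theorem subset_of_inter (h₁ : IsBlock G w ε C₁ E₁ Y₁) (h₂ : IsBlock G w ε C₂ E₂ Y₂)
    (h : (C₁ ∩ E₂).Nonempty) (n : ¬ (C₂ ∩ E₁).Nonempty) : E₁ ⊆ E₂ := by
  obtain ⟨x, hx₁, hx₂⟩ := h
  refine h₁.conn.subset_of_closed h₂.closed ?_ ⟨x, h₁.subset hx₁, hx₂⟩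
  rw [Set.disjoint_iff_inter_eq_empty, ← Set.not_nonempty_iff_eq_empty]
  exact fun hne => Set.disjoint_left.1 h₂.disjoint hx₂
    ((h₁.subset_commonNbrs_of_inter n hne).2 hx₁)

theorem exists_mixedOn (hG : HoleWithHatFree G) (h₁ : IsBlock G w ε C₁ E₁ Y₁)
    (h₂ : IsBlock G w ε C₂ E₂ Y₂) (h₂₁ : C₂ ⊆ commonNbrs G C₁) (h₁₂ : C₁ ⊆ commonNbrs G C₂)
    {u v : V} (hu : u ∈ E₁) (hu' : u ∉ C₁) (hv : v ∈ E₂) (huv : u = v ∨ G.Adj u v) :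
    ∃ a, a ∉ C₁ ∧ a ∈ commonNbrs G C₂ ∧ MixedOn G a C₁ := by
  obtain ⟨R, huR, hRX, hR, hRcl⟩ := exists_component (connSet_singleton G u)
    (X := E₁ \ C₁) (Set.singleton_subset_iff.2 ⟨hu, hu'⟩)
  have huR : u ∈ R := huR rfl
  have hRD : ∀ r ∈ R, r ∉ commonNbrs G C₁ := fun r hr =>
    Set.disjoint_left.1 h₁.disjoint (hRX hr).1
  have hRC : ∃ r ∈ R, ∃ c ∈ C₁, G.Adj r c := by
    obtain ⟨c, hc⟩ := h₁.nonempty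
    obtain ⟨r, -, hr, y, hy, hyR, hry⟩ := h₁.conn.exists_adj hu huR (h₁.subset hc)
      fun hcR => (hRX hcR).2 hc
    exact ⟨r, hr, y, by_contra fun hyC => hyR (hRcl r hr y ⟨hy, hyC⟩ hry), hry⟩
  obtain ⟨c₂, hc₂⟩ := h₂.nonempty
  have hq : ∃ q ∈ commonNbrs G C₁, q ∉ commonNbrs G C₂ ∧ ∃ r ∈ R, G.Adj r q := by
    by_cases hRD₂ : (R ∩ commonNbrs G C₂).Nonempty
    · obtain ⟨r, hr, hrD⟩ := hRD₂
      exact ⟨c₂, h₂₁ hc₂, fun h => h.1 hc₂, r, hr, hrD.2 c₂ hc₂⟩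
    · have hd : Disjoint R (commonNbrs G C₂) :=
        Set.disjoint_iff_inter_eq_empty.2 (Set.not_nonempty_iff_eq_empty.1 hRD₂)
      have huE : u ∈ E₂ := by
        rcases huv with rfl | huv
        · exact hv
        · exact (h₂.closed v hv u huv.symm).resolve_right (Set.disjoint_left.1 hd huR)
      obtain ⟨r, -, hr, q, hq, hqR, hrq⟩ := h₂.conn.exists_adj huE huR (h₂.subset hc₂)
        fun h => hRD c₂ h (h₂₁ hc₂)
      have hqD : q ∉ commonNbrs G C₂ := Set.disjoint_left.1 h₂.disjoint hq
      refine ⟨q, (h₁.closed r (hRX hr).1 q hrq).resolve_left fun hqE => ?_, hqD, r, hr, hrq⟩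
      exact hqR (hRcl r hr q ⟨hqE, fun hqC => hqD (h₁₂ hqC)⟩ hrq)
  obtain ⟨q, hq₁, hq₂, hRq⟩ := hq
  obtain ⟨a, ha, hap, ha'⟩ := hG.exists_attached (q := q) h₁.optimal.1.2.2.1 hR
    (fun p hp => (hq₁.2 p hp).symm) (Set.disjoint_left.2 fun p hp hpR => (hRX hpR).2 hp)
    (fun hqR => hRD q hqR hq₁) hRC hRq
  have haC := (hRX ha).2
  have hna : ¬ ∀ p ∈ C₁, G.Adj a p := fun h => hRD a ha ⟨haC, h⟩
  have haq := ha'.resolve_left hna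
  push Not at hna
  refine ⟨a, haC, ⟨fun haC₂ => hRD a ha (h₂₁ haC₂), ?_⟩, hap, hna⟩
  by_contra! hac
  obtain ⟨c, hc, hac⟩ := hac
  have hqc : ∃ x ∈ C₂, ¬ G.Adj q x := by
    by_contra! hcon
    exact hq₂ ⟨fun hqC => (hcon q hqC).ne rfl, hcon⟩
  refine hG.not_mixedOn h₁.anticonn (h₂.anticonn.insert hqc) ?_ ⟨hap, hna⟩
    ⟨⟨q, Set.mem_insert q C₂, haq⟩, c, Set.mem_insert_of_mem q hc, hac⟩
  rintro p hp y (rfl | hy)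
  · exact (hq₁.2 p hp).symm
  · exact ((h₂₁ hy).2 p hp).symm

theorem false_of_touching (hcoh : Coherent G w ε) (hw : IsWeight w) (hε : 0 < ε)
    (h6 : 6 * ε ≤ 1) (hG : HoleWithHatFree G) (h₁ : IsBlock G w ε C₁ E₁ Y₁)
    (h₂ : IsBlock G w ε C₂ E₂ Y₂) (h₂₁ : C₂ ⊆ commonNbrs G C₁) (h₁₂ : C₁ ⊆ commonNbrs G C₂)
    {u v : V} (hu : u ∈ E₁) (hu' : u ∉ C₁) (hv : v ∈ E₂) (hv' : v ∉ C₂)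
    (huv : u = v ∨ G.Adj u v) : False := by
  obtain ⟨a, haC, haD, ham⟩ := h₁.exists_mixedOn hG h₂ h₂₁ h₁₂ hu hu' hv huv
  obtain ⟨b, hbC, hbD, hbm⟩ := h₂.exists_mixedOn hG h₁ h₁₂ h₂₁ hv hv' hu
    (huv.imp Eq.symm fun h => h.symm)
  have hcomp : CompleteTo G C₁ (insert b C₂) := by
    rintro p hp y (rfl | hy)
    · exact (hbD.2 p hp).symm
    · exact ((h₂₁ hy).2 p hp).symm
  have hab : G.Adj a b := by
    by_contra hab
    obtain ⟨c, hc⟩ := h₂.nonempty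
    exact hG.not_mixedOn h₁.anticonn (h₂.anticonn.insert hbm.2) hcomp ham
      ⟨⟨c, Set.mem_insert_of_mem b hc, haD.2 c hc⟩, b, Set.mem_insert b C₂, hab⟩
  have hpair : IsCompletePair G (insert a C₁) (insert b C₂) :=
    { left_card := h₁.optimal.1.2.1.trans (Set.ncard_le_ncard (Set.subset_insert a C₁))
      right_card := h₂.optimal.1.2.1.trans (Set.ncard_le_ncard (Set.subset_insert b C₂))
      left_conn := h₁.optimal.1.2.2.1.insert (ham.1.imp fun p hp => ⟨hp.1, .inr hp.2⟩)
      right_conn := h₂.optimal.1.2.2.1.insert (hbm.1.imp fun p hp => ⟨hp.1, .inr hp.2⟩)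
      left_anticonn := h₁.anticonn.insert ham.2
      right_anticonn := h₂.anticonn.insert hbm.2
      complete := by
        rintro p (rfl | hp) y hy
        · rcases hy with rfl | hy
          · exact hab
          · exact haD.2 y hy
        · exact hcomp p hp y hy }
  obtain ⟨C, hC, hsub | hsub⟩ := hpair.exists_isSplit hcoh hw hε h6 hG
  · obtain rfl := h₁.optimal.2 C _ hC ((Set.subset_insert a C₁).trans hsub)
    exact haC (hsub (Set.mem_insert a C))
  · obtain rfl := h₂.optimal.2 C _ hC ((Set.subset_insert b C₂).trans hsub)
    exact hbC (hsub (Set.mem_insert b C))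

theorem inter_nonempty_of_touching (hcoh : Coherent G w ε) (hw : IsWeight w) (hε : 0 < ε)
    (h6 : 6 * ε ≤ 1) (hG : HoleWithHatFree G) (h₁ : IsBlock G w ε C₁ E₁ Y₁)
    (h₂ : IsBlock G w ε C₂ E₂ Y₂) {u v : V} (hu : u ∈ E₁) (hu' : u ∉ C₁) (hv : v ∈ E₂)
    (hv' : v ∉ C₂) (huv : u = v ∨ G.Adj u v) : (C₁ ∩ E₂).Nonempty ∨ (C₂ ∩ E₁).Nonempty := by
  by_contra! hcon
  simp only [← Set.not_nonempty_iff_eq_empty] at hcon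
  obtain ⟨h₂₁, h₁₂⟩ := h₁.subset_commonNbrs_of_touching h₂ hcon.1 hcon.2 hu hv huv
  exact h₁.false_of_touching hcoh hw hε h6 hG h₂ h₂₁ h₁₂ hu hu' hv hv' huv

theorem inter_nonempty_trichotomy (hcoh : Coherent G w ε) (hw : IsWeight w) (hε : 0 < ε)
    (h6 : 6 * ε ≤ 1) (hG : HoleWithHatFree G) (h₁ : IsBlock G w ε C₁ E₁ Y₁)
    (h₂ : IsBlock G w ε C₂ E₂ Y₂) (h₃ : IsBlock G w ε C₃ E₃ Y₃) (h₁₂ : (C₁ ∩ E₂).Nonempty)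
    (h₁₃ : (C₁ ∩ E₃).Nonempty) :
    (C₂ ∩ E₃).Nonempty ∨ (C₃ ∩ E₂).Nonempty ∨ (C₃ ∩ E₁).Nonempty := by
  by_contra! hcon
  simp only [← Set.not_nonempty_iff_eq_empty] at hcon
  obtain ⟨n₂₃, n₃₂, n₃₁⟩ := hcon
  obtain ⟨x, hx₁, hx₂⟩ := h₁₂
  have hx₃ : x ∈ E₃ := h₁.subset_of_inter h₃ h₁₃ n₃₁ (h₁.subset hx₁)
  exact (h₂.inter_nonempty_of_touching hcoh hw hε h6 hG h₃ hx₂ (fun hxC => n₂₃ ⟨x, hxC, hx₃⟩) hx₃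
    (fun hxC => n₃₂ ⟨x, hxC, hx₂⟩) (.inl rfl)).elim n₂₃ n₃₂

end IsBlock

/-! ### Chains of blocks -/

open Relation in
/-- If the successors of each element are comparable, modulo steps back to it, then so are an
element reachable from `i` and a successor of `i`. -/
theorem reflTransGen_or_of_step {ι : Type*} {R : ι → ι → Prop}
    (hR : ∀ i j k, R i j → R i k → R j k ∨ R k j ∨ R k i) {i m : ι} (h : ReflTransGen R i m) :
    ∀ k, R i k → ReflTransGen R k m ∨ ReflTransGen R m k := by
  induction h using ReflTransGen.head_induction_on with
  | refl => exact fun k hk => .inr (.single hk)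
  | head hij hjm ih =>
    intro k hk
    rcases hR _ _ k hij hk with h | h | h
    · exact ih k h
    · exact .inl (.head h hjm)
    · exact .inl (.head h (.head hij hjm))

open Relation in
theorem exists_maximal_reflTransGen {ι : Type*} [Finite ι] (R : ι → ι → Prop) (i : ι) :
    ∃ m, ReflTransGen R i m ∧ ∀ k, ReflTransGen R m k → ReflTransGen R k m := by
  obtain ⟨m, him, hm⟩ := (Set.toFinite {m | ReflTransGen R i m}).exists_minimalFor
    (fun m => {k | ReflTransGen R m k}) _ ⟨i, .refl⟩
  exact ⟨m, him, fun k hmk => hm (him.trans hmk) (fun _ h => hmk.trans h) .refl⟩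

open Relation in
/-- The union of the sets `E \ C` over all blocks is light. -/
theorem setSum_iUnion_lt (hcoh : Coherent G w ε) (hw : IsWeight w) (hε : 0 < ε)
    (h6 : 6 * ε ≤ 1) (hG : HoleWithHatFree G) {ι : Type*} [Finite ι] {C E Y : ι → Set V}
    (hB : ∀ i, IsBlock G w ε (C i) (E i) (Y i)) : setSum w (⋃ i, E i \ C i) < 3 * ε := by
  by_contra! hU
  obtain ⟨J, hJ, hJw⟩ := hcoh.exists_isBigComp hε hU
  let R : ι → ι → Prop := fun i j => (C i ∩ E j).Nonempty
  have hR : ∀ i j k, R i j → R i k → R j k ∨ R k j ∨ R k i := fun i j k =>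
    (hB i).inter_nonempty_trichotomy hcoh hw hε h6 hG (hB j) (hB k)
  have hY : ∀ i m, ReflTransGen R i m → Y m ⊆ Y i := by
    intro i m him
    induction him with
    | refl => exact subset_rfl
    | tail _ hjk ih => exact ((hB _).heavy_subset hw h6 (hB _) hjk).trans ih
  obtain ⟨v₀, hv₀⟩ := hJ.2.1.nonempty
  obtain ⟨i₀, hi₀⟩ := Set.mem_iUnion.1 (hJ.1 hv₀)
  obtain ⟨m, him, hm⟩ := exists_maximal_reflTransGen R i₀
  let X : Set V := {v | ∃ i, v ∈ E i \ C i ∧ ReflTransGen R i m}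
  have hJX : J ⊆ X := by
    intro v hv
    by_contra hvX
    obtain ⟨u, -, ⟨i, hui, him⟩, v, hvJ, hvX, huv⟩ := hJ.2.1.exists_adj (T := X) hv₀
      ⟨i₀, hi₀, him⟩ hv hvX
    obtain ⟨j, hvj⟩ := Set.mem_iUnion.1 (hJ.1 hvJ)
    refine hvX ⟨j, hvj, ?_⟩
    rcases (hB i).inter_nonempty_of_touching hcoh hw hε h6 hG (hB j) hui.1 hui.2 hvj.1 hvj.2
      (.inr huv) with h | h
    · exact (reflTransGen_or_of_step hR him j h).elim id (hm j)
    · exact .head h him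
  have hd : ∀ v ∈ J, ∀ y ∈ Y m, y ≠ v ∧ ¬ G.Adj v y := by
    intro v hv y hy
    obtain ⟨i, hvi, him⟩ := hJX hv
    have hyi := hY i m him hy
    have hyE := Set.disjoint_right.1 (hB i).disjoint_heavy hyi
    refine ⟨fun h => hyE (h ▸ hvi.1), fun h => ?_⟩
    exact ((hB i).closed v hvi.1 y h).elim hyE (Set.disjoint_left.1 (hB i).heavy_disjoint hyi)
  have hlt := hcoh.2.2 J (Y m) (Set.disjoint_left.2 fun v hv hvY => (hd v hv v hvY).1 rfl)
    fun v hv y hy => (hd v hv y hy).2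
  have := (hB m).heavy
  rcases min_lt_iff.1 hlt with h | h <;> linarith

/-! ### Forcers -/

instance : DecidableRel forcer.Adj := fun i j => by
  unfold forcer forcerRel
  rw [SimpleGraph.fromRel_adj]
  infer_instance

theorem isCompletePair_of_forcer {W : Type*} {H : SimpleGraph W} (f : forcer ↪g H) :
    IsCompletePair H {f 0, f 1, f 2, f 3} {f 4, f 5, f 6, f 7} := by
  have hadj : ∀ i j, forcer.Adj i j → H.Adj (f i) (f j) := fun i j h => f.map_adj_iff.2 h
  have hnadj : ∀ i j, ¬ forcer.Adj i j → ¬ H.Adj (f i) (f j) :=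
    fun i j h h' => h (f.map_adj_iff.1 h')
  have hcard : ∀ a b : Fin 8, a ≠ b → ∀ s : Set W, s.Finite → f a ∈ s → f b ∈ s →
      2 ≤ s.ncard := fun a b hab s hs ha hb =>
    (Set.one_lt_ncard_iff hs).2 ⟨f a, f b, ha, hb, f.injective.ne hab⟩
  have path : ∀ a b c d : Fin 8, forcer.Adj a b → forcer.Adj b c → forcer.Adj c d →
      ConnSet H {f a, f b, f c, f d} := fun a b c d hab hbc hcd =>
    (((connSet_singleton H (f d)).insert ⟨_, rfl, .inr (hadj _ _ hcd)⟩).insert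
      ⟨f c, by simp, .inr (hadj _ _ hbc)⟩).insert ⟨f b, by simp, .inr (hadj _ _ hab)⟩
  have antipath : ∀ a b c d : Fin 8, ¬ forcer.Adj a c → ¬ forcer.Adj b d → ¬ forcer.Adj a d →
      AnticonnSet H {f a, f b, f c, f d} := by
    intro a b c d hac hbd had
    have h := (((anticonnSet_iff.2 (connSet_singleton Hᶜ (f c))).insert
      ⟨_, rfl, hnadj _ _ hac⟩).insert ⟨f a, by simp, hnadj _ _ fun h => had h.symm⟩).insert
      ⟨f d, by simp, hnadj _ _ hbd⟩
    convert h using 1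
    ext x
    simp only [Set.mem_insert_iff, Set.mem_singleton_iff]
    tauto
  refine ⟨hcard 0 1 (by decide) _ (Set.toFinite _) (by simp) (by simp),
    hcard 4 5 (by decide) _ (Set.toFinite _) (by simp) (by simp),
    path 0 1 2 3 (by decide) (by decide) (by decide),
    path 4 5 6 7 (by decide) (by decide) (by decide),
    antipath 0 1 2 3 (by decide) (by decide) (by decide),
    antipath 4 5 6 7 (by decide) (by decide) (by decide), ?_⟩
  rintro _ (rfl | rfl | rfl | rfl) _ (rfl | rfl | rfl | rfl) <;> exact hadj _ _ (by decide)

end Weight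

theorem statement_14 {V : Type} [Fintype V] (G : SimpleGraph V) (w : V → ℝ) (ε : ℝ)
    (hε : 0 < ε) (h6 : 6 * ε ≤ 1) (hw : IsWeight w) (hcoh : Coherent G w ε)
    (hG : HoleWithHatFree G) :
    ∃ Z : Set V, 1 < Z.ncard ∧ ConnSet G Z ∧ Guarded (G.induce Z) ∧
      1 - 4 * ε < setSum w Z := by
  let ι := {C : Set V // IsOptimalSplit G w ε C (commonNbrs G C)}
  choose E Y hB using fun i : ι => i.2.exists_isBlock hcoh hw hε h6
  have hU := setSum_iUnion_lt hcoh hw hε h6 hG hB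
  have hU' := hw.setSum_compl (⋃ i : ι, E i \ i.1)
  obtain ⟨Z, hZ, hZw⟩ := hcoh.exists_isBigComp hε (X := (⋃ i : ι, E i \ i.1)ᶜ) (by linarith)
  refine ⟨Z, ?_, hZ.2.1, fun f => ?_, by linarith⟩
  · by_contra! hcard
    obtain ⟨z, hz⟩ := hZ.2.1.nonempty
    have hZz := hw.setSum_mono (X := Z) (Y := {z}) fun x hx =>
      (Set.ncard_le_one_iff).1 hcard hx hz
    rw [setSum_singleton] at hZz
    linarith [hcoh.1 z]
  obtain ⟨C₀, hC₀, hsub⟩ := (isCompletePair_of_forcer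
    ((SimpleGraph.Embedding.induce Z).comp f)).exists_isSplit hcoh hw hε h6 hG
  obtain ⟨C, hC₀C, hC⟩ := (Set.toFinite {C | IsSplit G w ε C (commonNbrs G C)}).exists_le_maximal
    hC₀
  have hopt : IsOptimalSplit G w ε C (commonNbrs G C) := by
    refine ⟨hC.prop, fun C' D' h hCC' => ?_⟩
    obtain rfl : D' = commonNbrs G C' := h.2.2.2.2.2.1
    exact (hC.le_of_ge h hCC').antisymm hCC'
  have hb := hB ⟨C, hopt⟩
  refine ⟨{z | z.1 ∈ C}, fun huniv => ?_, fun z hz => ?_, ?_⟩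
  · obtain ⟨d, hd⟩ := hopt.1.2.2.2.2.1
    have hCw := hcoh.setSum_lt_of_subset_neighborSet hw hd.2
    have hZC := hw.setSum_mono (X := Z) (Y := C) fun z hz =>
      huniv.ge (Set.mem_univ (⟨z, hz⟩ : Z))
    linarith
  · by_cases hzD : z.1 ∈ commonNbrs G C
    · exact .inl fun c hc => hzD.2 c.1 hc
    · refine .inr fun c hc hzc => ?_
      have hzE := (hb.closed c.1 (hb.subset hc) z.1 hzc.symm).resolve_right hzD
      exact hZ.1 z.2 (Set.mem_iUnion.2 ⟨⟨C, hopt⟩, hzE, hz⟩)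
  · have hsub' := hsub.imp (fun h => h.trans hC₀C) fun h => h.trans hC₀C
    refine hsub'.imp (fun h i hi => ?_) fun h i hi => ?_
    · apply h
      fin_cases i <;> simp at hi ⊢
    · apply h
      fin_cases i <;> simp at hi ⊢

end EHhat
end

section
/- Let α ≥ 2 be a real number, and let (G, f) be an α-critical pair. Then f(w) < 1 − 4^{−1/α} for each vertex w ∈ V(G). -/
open Finset

namespace EHhat

variable {V : Type*}

theorem cliqueNum_le_of_embedding {W : Type*} [Finite V] {H : SimpleGraph W} {G : SimpleGraph V}
    (e : H ↪g G) : H.cliqueNum ≤ G.cliqueNum := by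
  obtain ⟨s, hs⟩ := H.exists_isNClique_cliqueNum
  have hc : G.IsClique (s.map e.toEmbedding : Finset V) := by
    intro a ha b hb hab
    simp only [coe_map, Set.mem_image, mem_coe] at ha hb
    obtain ⟨x, hx, rfl⟩ := ha
    obtain ⟨y, hy, rfl⟩ := hb
    exact e.map_adj_iff.2 (hs.isClique hx hy fun h => hab (by rw [h]))
  simpa [hs.card_eq] using hc.card_le_cliqueNum

theorem chromaticNumber_eq_cliqueNum_iff [Finite V] {G : SimpleGraph V} :
    G.chromaticNumber = (G.cliqueNum : ℕ∞) ↔ G.Colorable G.cliqueNum := by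
  rw [← SimpleGraph.chromaticNumber_le_iff_colorable]
  exact ⟨le_of_eq, fun h => le_antisymm h G.cliqueNum_le_chromaticNumber⟩

/-- Perfection tested on all graphs that embed in `G`. -/
theorem isPerfect_iff_forall_embedding {V : Type} [Fintype V] {G : SimpleGraph V} :
    IsPerfect G ↔ ∀ (W : Type) (H : SimpleGraph W), Nonempty (H ↪g G) →
      H.Colorable H.cliqueNum := by
  classical
  constructor
  · rintro h W H ⟨e⟩
    have : Finite W := Finite.of_injective e e.injective
    have hT := chromaticNumber_eq_cliqueNum_iff.1 (h (Set.range e).toFinset)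
    let i : H ≃g G.induce ((Set.range e).toFinset : Set V) :=
      { toEquiv := (Equiv.ofInjective e e.injective).trans (Equiv.setCongr (by simp))
        map_rel_iff' := by
          intro a b
          exact e.map_adj_iff }
    exact (hT.of_hom i.toEmbedding.toHom).mono (cliqueNum_le_of_embedding i.symm.toEmbedding)
  · intro h S
    exact chromaticNumber_eq_cliqueNum_iff.2 (h _ _ ⟨SimpleGraph.Embedding.induce _⟩)

theorem IsPerfect.of_embedding {V W : Type} [Fintype V] [Fintype W] {G : SimpleGraph V}
    {H : SimpleGraph W} (h : IsPerfect G) (e : H ↪g G) : IsPerfect H :=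
  isPerfect_iff_forall_embedding.2 fun U K ⟨k⟩ =>
    isPerfect_iff_forall_embedding.1 h U K ⟨e.comp k⟩

theorem colorable_cliqueNum_of_universal {W : Type*} [Finite W] {H : SimpleGraph W} (u : W)
    (hu : ∀ v, v ≠ u → H.Adj u v)
    (hc : (H.induce {v | v ≠ u}).Colorable (H.induce {v | v ≠ u}).cliqueNum) :
    H.Colorable H.cliqueNum := by
  classical
  obtain ⟨s, hs⟩ := (H.induce {v | v ≠ u}).exists_isNClique_cliqueNum
  set n := (H.induce {v | v ≠ u}).cliqueNum
  have hclique : H.IsClique (insert u (s.map (Function.Embedding.subtype _)) : Finset W) := by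
    rw [coe_insert]
    refine SimpleGraph.IsClique.insert ?_ fun b _ hb => hu b hb.symm
    intro a ha b hb hab
    simp only [coe_map, Set.mem_image, mem_coe] at ha hb
    obtain ⟨x, hx, rfl⟩ := ha
    obtain ⟨y, hy, rfl⟩ := hb
    exact hs.isClique hx hy fun h => hab (by rw [h])
  have hle : n + 1 ≤ H.cliqueNum := by
    have := hclique.card_le_cliqueNum
    rwa [card_insert_of_notMem (by simp), card_map, hs.card_eq] at this
  refine SimpleGraph.Colorable.mono hle ?_
  obtain ⟨c⟩ := hc
  refine ⟨SimpleGraph.Coloring.mk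
    (fun v => if h : v ≠ u then (c ⟨v, h⟩).castSucc else Fin.last n) ?_⟩
  intro a b hab
  by_cases ha : a = u <;> by_cases hb : b = u
  · exact absurd hab (by simp [ha, hb])
  · simp [ha, hb, (Fin.castSucc_lt_last _).ne']
  · simp [ha, hb, (Fin.castSucc_lt_last _).ne]
  · have := c.valid (v := ⟨a, ha⟩) (w := ⟨b, hb⟩) hab
    simpa [ha, hb] using this

theorem colorable_cliqueNum_of_isolated {W : Type*} [Finite W] {H : SimpleGraph W} (u : W)
    (hu : ∀ v, ¬ H.Adj u v)
    (hc : (H.induce {v | v ≠ u}).Colorable (H.induce {v | v ≠ u}).cliqueNum) :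
    H.Colorable H.cliqueNum := by
  classical
  have hpos : 0 < H.cliqueNum := by
    have h1 : H.IsClique (({u} : Finset W) : Set W) := by simp
    simpa [Nat.one_le_iff_ne_zero, Nat.pos_iff_ne_zero] using h1.card_le_cliqueNum
  obtain ⟨c⟩ := hc.mono (cliqueNum_le_of_embedding (SimpleGraph.Embedding.induce {v | v ≠ u}))
  refine ⟨SimpleGraph.Coloring.mk
    (fun v => if h : v ≠ u then c ⟨v, h⟩ else ⟨0, hpos⟩) ?_⟩
  intro a b hab
  have ha : a ≠ u := fun h => hu b (h ▸ hab)
  have hb : b ≠ u := fun h => hu a (h ▸ hab.symm)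
  have := c.valid (v := ⟨a, ha⟩) (w := ⟨b, hb⟩) hab
  simpa [ha, hb] using this

/-- Adding a vertex complete or anticomplete to a perfect induced subgraph keeps it perfect. -/
theorem IsPerfect.insert {V : Type} [Fintype V] [DecidableEq V] {G : SimpleGraph V}
    {S : Finset V} {w : V} (hS : IsPerfect (G.induce (S : Set V)))
    (hw : (∀ v ∈ S, G.Adj w v) ∨ (∀ v ∈ S, ¬ G.Adj w v)) :
    IsPerfect (G.induce ((insert w S : Finset V) : Set V)) := by
  rw [isPerfect_iff_forall_embedding] at hS ⊢
  rintro W H ⟨e⟩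
  have : Finite W := Finite.of_injective e e.injective
  have hmem : ∀ x, (e x : V) ≠ w → (e x : V) ∈ S := fun x hx =>
    (mem_insert.1 (e x).2).resolve_left hx
  have hadj : ∀ {x y}, G.Adj (e x) (e y) ↔ H.Adj x y := e.map_adj_iff
  have hinj : ∀ {x y}, (e x : V) = e y → x = y := fun h => e.injective (Subtype.ext h)
  by_cases hu : ∃ u, (e u : V) = w
  · obtain ⟨u, hu⟩ := hu
    have hne : ∀ v, v ≠ u → (e v : V) ≠ w := fun v hv h => hv (hinj (h.trans hu.symm))
    have hadjw : ∀ {v}, G.Adj w (e v) ↔ H.Adj u v := fun {v} => by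
      have h := hadj (x := u) (y := v)
      rwa [hu] at h
    have hc := hS {v | v ≠ u} (H.induce {v | v ≠ u})
      ⟨{ toFun := fun x => ⟨e x.1, hmem x.1 (hne _ x.2)⟩
         inj' := fun x y hxy => by
           have h := congrArg Subtype.val hxy
           exact Subtype.ext (hinj h)
         map_rel_iff' := hadj }⟩
    rcases hw with hw | hw
    · exact colorable_cliqueNum_of_universal u
        (fun v hv => hadjw.1 (hw _ (hmem v (hne v hv)))) hc
    · refine colorable_cliqueNum_of_isolated u (fun v hv => ?_) hc
      exact hw _ (hmem v (hne v hv.ne')) (hadjw.2 hv)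
  · push Not at hu
    exact hS W H
      ⟨{ toFun := fun x => ⟨e x, hmem x (hu x)⟩
         inj' := fun x y hxy => by
           have h := congrArg Subtype.val hxy
           exact hinj h
         map_rel_iff' := hadj }⟩

theorem isPerfect_induce_empty {V : Type} [Fintype V] (G : SimpleGraph V) :
    IsPerfect (G.induce ((∅ : Finset V) : Set V)) := by
  rw [isPerfect_iff_forall_embedding]
  rintro W H ⟨e⟩
  have : IsEmpty W := ⟨fun x => by simpa using (e x).2⟩
  exact SimpleGraph.Colorable.of_isEmpty _

theorem isPerfect_induce_singleton {V : Type} [Fintype V] (G : SimpleGraph V) (v : V) :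
    IsPerfect (G.induce (({v} : Finset V) : Set V)) := by
  classical
  exact (isPerfect_induce_empty G).insert (w := v) (Or.inl (by simp))

/-- The scaled form of `α`-narrowness of `G[S]`. -/
theorem sum_rpow_le_of_narrow {V : Type} [Fintype V] {G : SimpleGraph V} {S : Finset V}
    {f : V → ℝ} {α c : ℝ} (hα : 0 < α) (hc : 0 ≤ c) (hf : ∀ v, 0 ≤ f v)
    (hN : Narrow (G.induce (S : Set V)) α)
    (hP : ∀ T ⊆ S, IsPerfect (G.induce (T : Set V)) → ∑ v ∈ T, f v ≤ c) :
    ∑ v ∈ S, f v ^ α ≤ c ^ α := by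
  rcases hc.eq_or_lt with rfl | hc
  · rw [Real.zero_rpow hα.ne']
    refine (sum_eq_zero fun v hv => ?_).le
    have := hP {v} (by simpa using hv) (isPerfect_induce_singleton G v)
    rw [sum_singleton] at this
    rw [le_antisymm this (hf v), Real.zero_rpow hα.ne']
  · have h := hN (fun v => f v / c) ⟨fun v => div_nonneg (hf v) hc.le, fun T hT => ?_⟩
    · simp only [Real.div_rpow (hf _) hc.le] at h
      rw [← sum_div, div_le_one (Real.rpow_pos_of_pos hc α)] at h
      refine le_of_eq_of_le ?_ h
      exact (sum_coe_sort S fun v => f v ^ α).symm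
    · rw [← sum_div, div_le_one hc]
      have := hP (T.map (Function.Embedding.subtype _))
        (fun v hv => by
          obtain ⟨x, -, rfl⟩ := mem_map.1 hv
          exact x.2)
        (hT.of_embedding
          { toFun := fun x =>
              ⟨⟨x.1, by
                obtain ⟨y, -, hy⟩ := mem_map.1 x.2
                exact hy ▸ y.2⟩, by
                obtain ⟨y, hyT, hy⟩ := mem_map.1 x.2
                have hxy : y = ⟨x.1, hy ▸ y.2⟩ := Subtype.ext hy
                exact hxy ▸ hyT⟩
            inj' := fun x y hxy =>
              Subtype.ext (congrArg (fun z => ((z.1 : (S : Set V)) : V)) hxy)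
            map_rel_iff' := Iff.rfl })
      simpa using this

theorem rpow_add_two_mul_rpow_le_one {α x : ℝ} (hα : 2 ≤ α) (hx1 : x ≤ 1)
    (hx : 1 - (4 : ℝ) ^ (-1 / α) ≤ x) : x ^ α + 2 * (1 - x) ^ α ≤ 1 := by
  have hα0 : 0 < α := by linarith
  set c : ℝ := (4 : ℝ) ^ (-1 / α) with hc
  have hc0 : 0 < c := by positivity
  have hcα : c ^ α = 1 / 4 := by
    rw [hc, ← Real.rpow_mul (by norm_num), div_mul_cancel₀ _ hα0.ne', Real.rpow_neg_one]
    norm_num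
  have hc1 : c ≤ 1 := Real.rpow_le_one_of_one_le_of_nonpos (by norm_num)
    (div_nonpos_of_nonpos_of_nonneg (by norm_num) hα0.le)
  have hc2 : 1 / 2 ≤ c := by
    have h : c ^ α ≤ c ^ (2 : ℝ) := Real.rpow_le_rpow_of_exponent_ge hc0 hc1 hα
    rw [hcα, Real.rpow_two] at h
    nlinarith
  have key : ∀ t : ℝ, 0 ≤ t → t ≤ 1 → t ^ α ≤ t ^ 2 := fun t h0 h1 => by
    rw [← Real.rpow_two]
    exact Real.rpow_le_rpow_of_exponent_ge_of_imp h0 h1 hα (fun _ h => by linarith)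
  obtain ⟨t, ht⟩ : ∃ t, 1 - x = t * c := ⟨(1 - x) / c, by field_simp⟩
  have ht0 : 0 ≤ t := by
    by_contra h
    nlinarith
  have ht1 : t ≤ 1 := by
    by_contra h
    nlinarith
  rw [ht, Real.mul_rpow ht0 hc0.le, hcα]
  have h1 := key t ht0 ht1
  have h2 := key x (by linarith) hx1
  nlinarith [mul_nonneg ht0 (sub_nonneg.2 hc2), mul_nonneg ht0 (sub_nonneg.2 ht1)]

theorem statement_15 {V : Type} [Fintype V] (G : SimpleGraph V) (f : V → ℝ) (α : ℝ)
    (hα : 2 ≤ α) (hcrit : Critical G f α) :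
    ∀ w : V, f w < 1 - (4 : ℝ) ^ (-1 / α) := by
  classical
  intro w
  by_contra! hx
  obtain ⟨⟨hf, hgood⟩, hnarrow, hsum⟩ := hcrit
  have hα0 : 0 < α := by linarith
  have hw1 : f w ≤ 1 := by
    simpa using hgood {w} (isPerfect_induce_singleton G w)
  have bound : ∀ S : Finset V, w ∉ S →
      ((∀ v ∈ S, G.Adj w v) ∨ (∀ v ∈ S, ¬ G.Adj w v)) →
      ∑ v ∈ S, f v ^ α ≤ (1 - f w) ^ α := by
    intro S hwS hS
    refine sum_rpow_le_of_narrow hα0 (sub_nonneg.2 hw1) hf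
      (hnarrow S fun h => hwS (h ▸ mem_univ w)) fun T hT hP => ?_
    have := hgood (insert w T) (hP.insert
      (hS.imp (fun h v hv => h v (hT hv)) (fun h v hv => h v (hT hv))))
    rw [sum_insert fun h => hwS (hT h)] at this
    linarith
  have hadj := bound {v ∈ univ.erase w | G.Adj w v} (by simp) (Or.inl (by simp))
  have hnon := bound {v ∈ univ.erase w | ¬ G.Adj w v} (by simp)
    (Or.inr fun v hv => (mem_filter.1 hv).2)
  rw [← add_sum_erase univ (fun v => f v ^ α) (mem_univ w),
    ← sum_filter_add_sum_filter_not _ (fun v => G.Adj w v)] at hsum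
  linarith [rpow_add_two_mul_rpow_le_one hα hw1 hx]

end EHhat
end

section
/- Let α ≥ 1 be a real number, and let (G, f) be an α-critical pair. Let A, B ⊆ V(G) be disjoint sets that are either complete to each other or anticomplete to each other. Then it is not the case that both Σ_{v∈A} (f(v))^α > 2^{−α} and Σ_{v∈B} (f(v))^α > 2^{−α}. -/
open Finset

namespace EHhat

variable {V : Type*}

/-- `G[U]` has a clique `K` and a proper coloring with `#K` colors. -/
def HasTightColoring (G : SimpleGraph V) (U : Set V) : Prop :=
  ∃ K : Finset V, (K : Set V) ⊆ U ∧ G.IsClique K ∧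
    ∃ c : V → ℕ, (∀ v ∈ U, c v < #K) ∧ ∀ u ∈ U, ∀ v ∈ U, G.Adj u v → c u ≠ c v

theorem chromaticNumber_eq_cliqueNum_iff_s16 {W : Type*} [Finite W] (H : SimpleGraph W) :
    H.chromaticNumber = (H.cliqueNum : ℕ∞) ↔
      ∃ K : Finset W, H.IsClique K ∧ H.Colorable #K := by
  constructor
  · intro h
    obtain ⟨K, hK⟩ := H.exists_isNClique_cliqueNum
    refine ⟨K, hK.isClique, ?_⟩
    rw [hK.card_eq]
    exact SimpleGraph.chromaticNumber_le_iff_colorable.1 h.le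
  · rintro ⟨K, hK, hc⟩
    refine le_antisymm (hc.chromaticNumber_le.trans ?_) H.cliqueNum_le_chromaticNumber
    exact_mod_cast SimpleGraph.IsClique.card_le_cliqueNum (tc := hK)

theorem chromaticNumber_eq_cliqueNum_iff_hasTightColoring {W : Type*} [Finite W]
    {H : SimpleGraph W} {G : SimpleGraph V} (φ : H ↪g G) :
    H.chromaticNumber = (H.cliqueNum : ℕ∞) ↔ HasTightColoring G (Set.range φ) := by
  classical
  rw [chromaticNumber_eq_cliqueNum_iff_s16]
  constructor
  · rintro ⟨K, hK, hc⟩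
    obtain ⟨C, hC⟩ := (SimpleGraph.colorable_iff_exists_bdd_nat_coloring _).1 hc
    refine ⟨K.map φ.toEmbedding, ?_, ?_, Function.extend φ C 0, ?_, ?_⟩
    · rw [Finset.coe_map]
      exact Set.image_subset_range _ _
    · intro u hu v hv huv
      simp only [Finset.coe_map, Set.mem_image] at hu hv
      obtain ⟨a, ha, rfl⟩ := hu
      obtain ⟨b, hb, rfl⟩ := hv
      exact φ.map_adj_iff.2 (hK ha hb fun h => huv (by rw [h]))
    · rintro _ ⟨a, rfl⟩
      rw [φ.injective.extend_apply, Finset.card_map]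
      exact hC a
    · rintro _ ⟨a, rfl⟩ _ ⟨b, rfl⟩ hab
      rw [φ.injective.extend_apply, φ.injective.extend_apply]
      exact C.valid (φ.map_adj_iff.1 hab)
  · rintro ⟨K, hKU, hK, c, hc, hcadj⟩
    have hcard : #(K.preimage φ φ.injective.injOn) = #K := by
      rw [Finset.card_preimage]
      congr 1
      exact Finset.filter_true_of_mem fun v hv => hKU hv
    refine ⟨K.preimage φ φ.injective.injOn, ?_, ?_⟩
    · intro a ha b hb hab
      simp only [Finset.coe_preimage, Set.mem_preimage] at ha hb
      exact φ.map_adj_iff.1 (hK ha hb (φ.injective.ne hab))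
    · rw [hcard, SimpleGraph.colorable_iff_exists_bdd_nat_coloring]
      exact ⟨SimpleGraph.Coloring.mk (fun a => c (φ a)) fun {a b} hab =>
        hcadj _ ⟨a, rfl⟩ _ ⟨b, rfl⟩ (φ.map_adj_iff.2 hab), fun a => hc _ ⟨a, rfl⟩⟩

theorem isPerfect_iff_hasTightColoring {W : Type*} [Fintype W]
    {H : SimpleGraph W} {G : SimpleGraph V} (φ : H ↪g G) :
    IsPerfect H ↔ ∀ U ⊆ Set.range φ, HasTightColoring G U := by
  have key (S : Set W) : Set.range ((SimpleGraph.Embedding.induce S).trans φ) = φ '' S := by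
    ext v
    simp
  constructor
  · intro h U hU
    obtain ⟨S, rfl⟩ := Set.subset_range_iff_exists_image_eq.1 hU
    have := h S.toFinite.toFinset
    rwa [chromaticNumber_eq_cliqueNum_iff_hasTightColoring
      ((SimpleGraph.Embedding.induce _).trans φ), key, Set.Finite.coe_toFinset] at this
  · intro h S
    rw [chromaticNumber_eq_cliqueNum_iff_hasTightColoring
      ((SimpleGraph.Embedding.induce _).trans φ), key]
    exact h _ (Set.image_subset_range _ _)

theorem isPerfect_induce_iff (G : SimpleGraph V) (S : Finset V) :
    IsPerfect (G.induce (S : Set V)) ↔ ∀ U ⊆ (S : Set V), HasTightColoring G U := by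
  rw [isPerfect_iff_hasTightColoring (SimpleGraph.Embedding.induce (S : Set V))]
  have : Set.range (SimpleGraph.Embedding.induce (G := G) (S : Set V)) = S := Subtype.range_coe
  rw [this]

theorem CompleteTo.hasTightColoring_union {G : SimpleGraph V} {S T : Set V}
    (hST : CompleteTo G S T) (hS : HasTightColoring G S) (hT : HasTightColoring G T) :
    HasTightColoring G (S ∪ T) := by
  classical
  obtain ⟨K, hKS, hK, c, hc, hcadj⟩ := hS
  obtain ⟨L, hLT, hL, d, hd, hdadj⟩ := hT
  have hdisj : ∀ v ∈ S, v ∉ T := fun v hv hv' => (hST v hv v hv').ne rfl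
  have hKL : Disjoint K L := Finset.disjoint_left.2 fun v hv hv' => hdisj v (hKS hv) (hLT hv')
  refine ⟨K ∪ L, ?_, ?_, fun v => if v ∈ S then c v else #K + d v, ?_, ?_⟩
  · rw [Finset.coe_union]
    exact Set.union_subset_union hKS hLT
  · intro u hu v hv huv
    rw [Finset.coe_union] at hu hv
    rcases hu with hu | hu <;> rcases hv with hv | hv
    · exact hK hu hv huv
    · exact hST u (hKS hu) v (hLT hv)
    · exact (hST v (hKS hv) u (hLT hu)).symm
    · exact hL hu hv huv
  · rw [Finset.card_union_of_disjoint hKL]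
    grind
  · grind

theorem AnticompleteTo.hasTightColoring_union {G : SimpleGraph V} {S T : Set V}
    (hST : AnticompleteTo G S T) (hdisj : Disjoint S T)
    (hS : HasTightColoring G S) (hT : HasTightColoring G T) :
    HasTightColoring G (S ∪ T) := by
  classical
  obtain ⟨K, hKS, hK, c, hc, hcadj⟩ := hS
  obtain ⟨L, hLT, hL, d, hd, hdadj⟩ := hT
  have hdisj' : ∀ v ∈ S, v ∉ T := fun _ hv => Set.disjoint_left.1 hdisj hv
  have hsymm : ∀ u ∈ T, ∀ v ∈ S, ¬ G.Adj u v := fun u hu v hv h => hST v hv u hu h.symm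
  obtain ⟨M, hM, hMclique, hKM, hLM⟩ : ∃ M : Finset V, (M : Set V) ⊆ S ∪ T ∧ G.IsClique M ∧
      #K ≤ #M ∧ #L ≤ #M := by
    rcases le_total #K #L with h | h
    · exact ⟨L, hLT.trans Set.subset_union_right, hL, h, le_rfl⟩
    · exact ⟨K, hKS.trans Set.subset_union_left, hK, le_rfl, h⟩
  refine ⟨M, hM, hMclique, fun v => if v ∈ S then c v else d v, ?_, ?_⟩
  · grind
  · unfold AnticompleteTo at hST
    grind

theorem isPerfect_induce_union [DecidableEq V] {G : SimpleGraph V} {S T : Finset V}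
    (hdisj : Disjoint S T) (hST : CompleteTo G S T ∨ AnticompleteTo G S T)
    (hS : IsPerfect (G.induce (S : Set V))) (hT : IsPerfect (G.induce (T : Set V))) :
    IsPerfect (G.induce ((S ∪ T : Finset V) : Set V)) := by
  rw [isPerfect_induce_iff] at *
  intro U hU
  rw [Finset.coe_union] at hU
  rw [← Set.inter_eq_left.2 hU, Set.inter_union_distrib_left]
  have hS' := hS _ (Set.inter_subset_right (s := U))
  have hT' := hT _ (Set.inter_subset_right (s := U))
  rcases hST with h | h
  · exact CompleteTo.hasTightColoring_union (fun a ha b hb => h a ha.2 b hb.2) hS' hT'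
  · exact AnticompleteTo.hasTightColoring_union (fun a ha b hb => h a ha.2 b hb.2)
      ((Finset.disjoint_coe.2 hdisj).mono Set.inter_subset_right Set.inter_subset_right) hS' hT'

theorem isPerfect_induce_map {G : SimpleGraph V} {A : Set V} (S : Finset A) :
    IsPerfect (G.induce ((S.map (Function.Embedding.subtype _) : Finset V) : Set V)) ↔
      IsPerfect ((G.induce A).induce (S : Set A)) := by
  rw [isPerfect_induce_iff, isPerfect_iff_hasTightColoring
    ((SimpleGraph.Embedding.induce (S : Set A)).trans (SimpleGraph.Embedding.induce A))]
  have : Set.range ((SimpleGraph.Embedding.induce (S : Set A)).trans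
      (SimpleGraph.Embedding.induce (G := G) A)) =
      ((S.map (Function.Embedding.subtype _) : Finset V) : Set V) := by
    rw [Finset.coe_map]
    exact (Set.range_comp (Subtype.val : A → V) (Subtype.val : ↥(S : Set A) → A)).trans
      (congrArg (Set.image (Subtype.val : A → V)) Subtype.range_coe)
  rw [this]

/-- If the induced subgraph on `A` is `α`-narrow and the `α`-powers sum to more than `2 ^ (-α)`
on `A`, then some perfect induced subgraph inside `A` has weight more than `1 / 2`. -/
theorem exists_isPerfect_half_lt {G : SimpleGraph V} {f : V → ℝ} {α : ℝ}
    (hf : ∀ v, 0 ≤ f v) {A : Finset V} (hA : Narrow (G.induce (A : Set V)) α)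
    (hsum : (2 : ℝ) ^ (-α) < ∑ v ∈ A, f v ^ α) :
    ∃ S ⊆ A, IsPerfect (G.induce (S : Set V)) ∧ 1 / 2 < ∑ v ∈ S, f v := by
  by_contra! hcon
  have hgood : GoodOn (G.induce (A : Set V)) (fun v => 2 * f v) := by
    refine ⟨fun v => mul_nonneg zero_le_two (hf v), fun S hS => ?_⟩
    have h := hcon _ (fun v hv => ?_) ((isPerfect_induce_map S).2 hS)
    · rw [Finset.sum_map] at h
      simp only [Function.Embedding.subtype_apply] at h
      rw [← Finset.mul_sum]
      linarith
    · obtain ⟨a, -, rfl⟩ := Finset.mem_map.1 hv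
      exact a.2
  have h := hA _ hgood
  have hpow (v : V) : (2 * f v) ^ α = 2 ^ α * f v ^ α := Real.mul_rpow zero_le_two (hf v)
  simp only [hpow] at h
  rw [← Finset.mul_sum] at h
  have hcoe : ∑ v : (A : Set V), f v ^ α = ∑ v ∈ A, f v ^ α :=
    Finset.sum_coe_sort A fun v => f v ^ α
  rw [hcoe] at h
  have hpos : (0 : ℝ) < 2 ^ α := Real.rpow_pos_of_pos two_pos α
  have := mul_lt_mul_of_pos_left hsum hpos
  rw [← Real.rpow_add two_pos, add_neg_cancel, Real.rpow_zero] at this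
  linarith

theorem setSum_coe [Fintype V] (f : V → ℝ) (A : Finset V) :
    setSum f (A : Set V) = ∑ v ∈ A, f v :=
  Finset.sum_indicator_subset f (Finset.subset_univ A)

theorem statement_16 {V : Type} [Fintype V] (G : SimpleGraph V) (f : V → ℝ) (α : ℝ)
    (hα : 1 ≤ α) (hcrit : Critical G f α)
    (A B : Set V) (hdisj : Disjoint A B)
    (hAB : CompleteTo G A B ∨ AnticompleteTo G A B) :
    ¬ ((2 : ℝ) ^ (-α) < setSum (fun v => f v ^ α) A ∧
       (2 : ℝ) ^ (-α) < setSum (fun v => f v ^ α) B) := by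
  classical
  rintro ⟨hA, hB⟩
  lift A to Finset V using A.toFinite
  lift B to Finset V using B.toFinite
  rw [setSum_coe] at hA hB
  rw [Finset.disjoint_coe] at hdisj
  obtain ⟨⟨hf, hperf⟩, hnarrow, -⟩ := hcrit
  have nonempty_of_lt {X : Finset V} (h : (2 : ℝ) ^ (-α) < ∑ v ∈ X, f v ^ α) : X.Nonempty := by
    rw [Finset.nonempty_iff_ne_empty]
    rintro rfl
    exact (Real.rpow_pos_of_pos two_pos (-α)).not_gt (by simpa using h)
  have hAne : A ≠ Finset.univ := by
    rintro rfl
    obtain ⟨b, hb⟩ := nonempty_of_lt hB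
    exact Finset.disjoint_left.1 hdisj (Finset.mem_univ b) hb
  have hBne : B ≠ Finset.univ := by
    rintro rfl
    obtain ⟨a, ha⟩ := nonempty_of_lt hA
    exact Finset.disjoint_left.1 hdisj ha (Finset.mem_univ a)
  obtain ⟨S, hSA, hS, hSsum⟩ := exists_isPerfect_half_lt hf (hnarrow A hAne) hA
  obtain ⟨T, hTB, hT, hTsum⟩ := exists_isPerfect_half_lt hf (hnarrow B hBne) hB
  have hST : Disjoint S T := hdisj.mono hSA hTB
  have hunion := hperf (S ∪ T) (isPerfect_induce_union hST
    (hAB.imp (fun h a ha b hb => h a (hSA ha) b (hTB hb))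
      fun h a ha b hb => h a (hSA ha) b (hTB hb)) hS hT)
  rw [Finset.sum_union hST] at hunion
  linarith

end EHhat
end

section
/- For every ε > 0 there exists δ > 0 such that, if G is a house-free graph with |V(G)| > 1, then either there are disjoint sets A, B ⊆ V(G), complete to each other, with |A|, |B| ≥ εδ|V(G)|, or there exists X ⊆ V(G) with |X| ≥ δ|V(G)| such that the induced subgraph G[X] has maximum degree less than ε|X|. -/
open Finset

namespace EHhat

variable {V : Type*}

/-- `H` has no induced path on five vertices; the vertices of such a path are automatically
distinct. -/
def NoInducedP5 (H : SimpleGraph V) : Prop :=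
  ∀ a b c d e, H.Adj a b → H.Adj b c → H.Adj c d → H.Adj d e →
    ¬H.Adj a c → ¬H.Adj a d → ¬H.Adj a e → ¬H.Adj b d → ¬H.Adj b e → ¬H.Adj c e → False

/-- No two disjoint sets of at least `t` vertices are anticomplete. -/
def NoAnticompletePair (H : SimpleGraph V) (t : ℕ) : Prop :=
  ∀ A B : Finset V, Disjoint A B → t ≤ #A → t ≤ #B → ∃ a ∈ A, ∃ b ∈ B, H.Adj a b

/-- Every partition of `K` into two nonempty parts is crossed by an edge. -/
def CutConnected (H : SimpleGraph V) (K : Finset V) : Prop :=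
  ∀ A ⊆ K, A.Nonempty → A ≠ K → ∃ a ∈ A, ∃ b ∈ K, b ∉ A ∧ H.Adj a b

lemma HouseFree.noInducedP5_compl {G : SimpleGraph V} (hG : HouseFree G) : NoInducedP5 Gᶜ := by
  intro a b c d e hab hbc hcd hde hac had hae hbd hbe hce
  have hac' : a ≠ c := by rintro rfl; exact had hcd
  have had' : a ≠ d := by rintro rfl; exact hae hde
  have hae' : a ≠ e := by rintro rfl; exact had hde.symm
  have hbd' : b ≠ d := by rintro rfl; exact had hab
  have hbe' : b ≠ e := by rintro rfl; exact hae hab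
  have hce' : c ≠ e := by rintro rfl; exact hbe hbc
  rw [SimpleGraph.compl_adj] at *
  have hinj : Function.Injective ![a, b, c, d, e] := by
    intro i j hij
    fin_cases i <;> fin_cases j <;> simp_all
  refine hG.false ⟨⟨![a, b, c, d, e], hinj⟩, ?_⟩
  intro i j
  fin_cases i <;> fin_cases j <;>
    simp_all [house, SimpleGraph.pathGraph_adj, G.adj_comm]

section

open Classical

/-- A large set contains a connected part that is isolated in it and misses few vertices. -/
lemma NoAnticompletePair.exists_giant {H : SimpleGraph V} {t : ℕ}
    (hH : NoAnticompletePair H t) {S : Finset V} (hS : 3 * t ≤ #S) :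
    ∃ K ⊆ S, #S ≤ #K + t ∧ CutConnected H K ∧ ∀ a ∈ K, ∀ b ∈ S, b ∉ K → ¬H.Adj a b := by
  let F := S.powerset.filter fun K => #S ≤ #K + t ∧ ∀ a ∈ K, ∀ b ∈ S, b ∉ K → ¬H.Adj a b
  have hF : F.Nonempty := ⟨S, by simp [F]; tauto⟩
  obtain ⟨K, hKF, hmin⟩ := F.exists_min_image (fun K => #K) hF
  simp only [F, mem_filter, mem_powerset] at hKF hmin
  obtain ⟨hKS, hcard, hK⟩ := hKF
  refine ⟨K, hKS, hcard, ?_, hK⟩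
  -- an isolated part of size at least `t` is almost all of `S`, hence all of `K`
  have key : ∀ A ⊆ K, (∀ a ∈ A, ∀ b ∈ K, b ∉ A → ¬H.Adj a b) → t ≤ #A → #K ≤ #A := by
    intro A hA hcut hAt
    have hAS : ∀ a ∈ A, ∀ b ∈ S, b ∉ A → ¬H.Adj a b := by
      intro a ha b hb hbA
      by_cases hbK : b ∈ K
      · exact hcut a ha b hbK hbA
      · exact hK a (hA ha) b hb hbK
    refine hmin A ⟨hA.trans hKS, ?_, hAS⟩
    have h1 := card_sdiff_add_card_eq_card (hA.trans hKS)
    by_contra hlt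
    obtain ⟨a, ha, b, hb, hab⟩ := hH A (S \ A) disjoint_sdiff hAt (by omega)
    rw [mem_sdiff] at hb
    exact hAS a ha b hb.1 hb.2 hab
  intro A hA hne hneK
  by_contra! hcut
  have hlt := card_lt_card (hA.ssubset_of_ne hneK)
  have hpos := hne.card_pos
  have h1 := card_sdiff_add_card_eq_card hA
  by_cases hAt : t ≤ #A
  · have := key A hA hcut hAt
    omega
  · have := key (K \ A) sdiff_subset (by
      intro a ha b hb hbA hab
      simp only [mem_sdiff, not_and, not_not] at ha hbA
      exact hcut b (hbA hb) a ha.1 ha.2 hab.symm) (by omega)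
    omega

lemma CutConnected.exists_mixed_edge {H : SimpleGraph V} {K : Finset V} (hK : CutConnected H K)
    {b x y : V} (hx : x ∈ K) (hbx : H.Adj b x) (hy : y ∈ K) (hby : ¬H.Adj b y) :
    ∃ k ∈ K, ∃ l ∈ K, H.Adj b k ∧ ¬H.Adj b l ∧ H.Adj k l := by
  obtain ⟨k, hk, l, hl, hlA, hkl⟩ := hK (K.filter (H.Adj b)) (filter_subset _ _)
    ⟨x, by simp [hx, hbx]⟩ (fun h => hby (by rw [← h] at hy; exact (mem_filter.1 hy).2))
  simp only [mem_filter, not_and] at hk hlA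
  exact ⟨k, hk.1, l, hl, hk.2, hlA hl, hkl⟩

/-- The end of an induced path on three vertices cannot be mixed on a connected set which the
other two vertices do not see. -/
lemma NoInducedP5.complete_or_anticomplete {H : SimpleGraph V} (hP : NoInducedP5 H)
    {K : Finset V} (hK : CutConnected H K) {v a b : V} (hva : H.Adj v a) (hab : H.Adj a b)
    (hvb : ¬H.Adj v b) (hvK : ∀ k ∈ K, ¬H.Adj v k) (haK : ∀ k ∈ K, ¬H.Adj a k) :
    (∀ k ∈ K, H.Adj b k) ∨ ∀ k ∈ K, ¬H.Adj b k := by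
  by_contra! h
  obtain ⟨⟨y, hy, hby⟩, x, hx, hbx⟩ := h
  obtain ⟨k, hk, l, hl, hbk, hbl, hkl⟩ := hK.exists_mixed_edge hx hbx hy hby
  exact hP v a b k l hva hab hbk hkl hvb (hvK k hk) (hvK l hl) (haK k hk) (haK l hl) hbl

lemma NoInducedP5.exists_large_degree {H : SimpleGraph V} (hP : NoInducedP5 H) {t d : ℕ}
    (hH : NoAnticompletePair H t) {S : Finset V} (hS : 6 * t + 3 * d + 3 ≤ #S) :
    ∃ v ∈ S, d < #(S.filter (H.Adj v)) := by
  by_contra! hd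
  have hsub : ∀ {K : Finset V}, K ⊆ S → ∀ v ∈ S, #(K.filter (H.Adj v)) ≤ d := fun hK v hv =>
    (card_le_card (filter_subset_filter _ hK)).trans (hd v hv)
  obtain ⟨K₀, hK₀S, hc₀, hK₀, -⟩ := hH.exists_giant (S := S) (by omega)
  obtain ⟨v, hv⟩ : K₀.Nonempty := card_pos.1 (by omega)
  have hdv := hsub hK₀S v (hK₀S hv)
  have hsplit := card_filter_add_card_filter_not (s := K₀) (H.Adj v)
  set S₁ := (K₀.filter fun x => ¬H.Adj v x).erase v with hS₁
  have hcS₁ : #S₁ = #(K₀.filter fun x => ¬H.Adj v x) - 1 :=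
    card_erase_of_mem (by simp [hv])
  obtain ⟨K₁, hK₁S, hc₁, hK₁, hiso₁⟩ := hH.exists_giant (S := S₁) (by omega)
  have hK₁' : ∀ x ∈ K₁, x ≠ v ∧ x ∈ K₀ ∧ ¬H.Adj v x := fun x hx => by
    simpa [hS₁] using hK₁S hx
  have hK₁K₀ : K₁ ⊆ K₀ := fun x hx => (hK₁' x hx).2.1
  obtain ⟨k, hk, a, ha, haK₁, hka⟩ := hK₀ K₁ hK₁K₀ (card_pos.1 (by omega))
    (fun h => (hK₁' v (h ▸ hv)).1 rfl)
  have hva : H.Adj v a := by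
    by_contra hva
    refine hiso₁ k hk a ?_ haK₁ hka
    simp only [hS₁, mem_erase, mem_filter]
    exact ⟨fun h => (hK₁' k hk).2.2 (h ▸ hka.symm), ha, hva⟩
  have hda := hsub (hK₁K₀.trans hK₀S) a (hK₀S ha)
  have hsplit₁ := card_filter_add_card_filter_not (s := K₁) (H.Adj a)
  obtain ⟨K₂, hK₂S, hc₂, hK₂, hiso₂⟩ :=
    hH.exists_giant (S := K₁.filter fun x => ¬H.Adj a x) (by omega)
  have hK₂' : ∀ x ∈ K₂, x ∈ K₁ ∧ ¬H.Adj a x := fun x hx => by simpa using hK₂S hx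
  have hK₂K₁ : K₂ ⊆ K₁ := fun x hx => (hK₂' x hx).1
  obtain ⟨l, hl, b, hb, hbK₂, hlb⟩ := hK₁ K₂ hK₂K₁ (card_pos.1 (by omega))
    (fun h => (hK₂' k (h ▸ hk)).2 hka.symm)
  have hab : H.Adj a b := by
    by_contra hab
    exact hiso₂ l hl b (by simp [hb, hab]) hbK₂ hlb
  have hcomp : ∀ x ∈ K₂, H.Adj b x := by
    refine (hP.complete_or_anticomplete hK₂ hva hab (hK₁' b hb).2.2
      (fun x hx => (hK₁' x (hK₂K₁ hx)).2.2) (fun x hx => (hK₂' x hx).2)).resolve_right ?_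
    exact fun h => h l hl hlb.symm
  have hdb := hsub (hK₂K₁.trans (hK₁K₀.trans hK₀S)) b (hK₀S (hK₁K₀ hb))
  rw [filter_true_of_mem hcomp] at hdb
  omega

/-- Without large anticomplete pairs, a large set of vertices of a `P₅`-free graph contains
a large almost complete set, or a large almost complete pair. -/
lemma NoInducedP5.exists_dense_set_or_pair {H : SimpleGraph V} (hP : NoInducedP5 H) {t p : ℕ}
    (hH : NoAnticompletePair H t) (ht : 0 < t) {W : Finset V} (hW : 1000 * t ≤ #W)
    (hp : 1000 * t ≤ p) :
    (∃ X ⊆ W, #W ≤ 2 * #X ∧ ∀ x ∈ X, #(W.filter fun y => x ≠ y ∧ ¬H.Adj x y) < p) ∨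
    (∃ X ⊆ W, p ≤ 2 * #X ∧ ∀ x ∈ X, #(X.filter fun y => ¬H.Adj x y) ≤ 3 * t) ∨
    (∃ A ⊆ W, ∃ B ⊆ W, Disjoint A B ∧ #W ≤ 40 * #A ∧ p ≤ #B ∧
      ∀ a ∈ A, #(B.filter fun y => ¬H.Adj a y) ≤ 3 * t) ∨
    (∃ A ⊆ W, ∃ B ⊆ W, Disjoint A B ∧ t ≤ #A ∧ t ≤ #B ∧ ∀ a ∈ A, ∀ b ∈ B, H.Adj a b) := by
  rw [or_iff_not_imp_left]
  intro hsparse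
  set D := W.filter fun x => #(W.filter fun y => x ≠ y ∧ ¬H.Adj x y) < p with hD
  have hDcard : 2 * #D < #W := by
    by_contra! h
    exact hsparse ⟨D, filter_subset _ _, h, fun x hx => (mem_filter.1 hx).2⟩
  have hDW : D ⊆ W := filter_subset _ _
  have hWD := card_sdiff_add_card_eq_card hDW
  obtain ⟨v, hv, hdeg⟩ := hP.exists_large_degree hH (S := W \ D) (d := #W / 20) (by omega)
  rw [mem_sdiff] at hv
  set A := W.filter (H.Adj v) with hA
  set B := W.filter fun y => v ≠ y ∧ ¬H.Adj v y with hB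
  have hAcard : #W / 20 < #A := hdeg.trans_le (card_le_card (filter_subset_filter _ sdiff_subset))
  have hBcard : p ≤ #B := by
    by_contra! h
    exact hv.2 (by rw [hD, mem_filter]; exact ⟨hv.1, h⟩)
  have hAW : A ⊆ W := filter_subset _ _
  have hBW : B ⊆ W := filter_subset _ _
  have hAB : Disjoint A B := by
    rw [disjoint_left]
    intro x hx hx'
    simp only [hA, hB, mem_filter] at hx hx'
    exact hx'.2.2 hx.2
  have hvB : ∀ x ∈ B, ¬H.Adj v x := fun x hx => by
    simp only [hB, mem_filter] at hx
    exact hx.2.2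
  rw [or_iff_not_imp_right, not_or]
  rintro ⟨hpair, hexact⟩
  set A₂ := A.filter fun a => #(B.filter fun y => ¬H.Adj a y) ≤ 3 * t with hA₂
  have hA₂card : 40 * #A₂ < #W := by
    by_contra! h
    exact hpair ⟨A₂, (filter_subset _ _).trans hAW, B, hBW,
      hAB.mono_left (filter_subset _ _), h, hBcard, fun a ha => (mem_filter.1 ha).2⟩
  have hA₂A : A₂ ⊆ A := filter_subset _ _
  have hA₁card := card_sdiff_add_card_eq_card hA₂A
  set Bs := B.filter fun b => #(B.filter (H.Adj b)) ≤ 3 * t with hBs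
  set Bd := B.filter fun b => #(B.filter fun y => ¬H.Adj b y) ≤ 3 * t with hBd
  have hcover : ∀ a ∈ A \ A₂, ∀ b ∈ B, H.Adj a b → b ∈ Bs ∪ Bd := by
    intro a ha b hb hab
    rw [mem_sdiff] at ha
    have hva : H.Adj v a := (mem_filter.1 ha.1).2
    have hsplit := card_filter_add_card_filter_not (s := B) (H.Adj a)
    have hlarge : 3 * t < #(B.filter fun y => ¬H.Adj a y) := by
      by_contra! h
      exact ha.2 (by rw [hA₂, mem_filter]; exact ⟨ha.1, h⟩)
    obtain ⟨K, hKS, hKcard, hK, -⟩ := hH.exists_giant hlarge.le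
    have hKB : K ⊆ B := hKS.trans (filter_subset _ _)
    have haK : ∀ k ∈ K, ¬H.Adj a k := fun k hk => (mem_filter.1 (hKS hk)).2
    have hdich : ∀ x ∈ B, H.Adj a x → (∀ k ∈ K, H.Adj x k) ∨ ∀ k ∈ K, ¬H.Adj x k :=
      fun x hx hax => hP.complete_or_anticomplete hK hva hax (hvB x hx)
        (fun k hk => hvB k (hKB hk)) haK
    have hsmall : #(B.filter (H.Adj a)) < 2 * t := by
      by_contra! h
      set N := B.filter (H.Adj a) with hN
      have hNsplit := card_filter_add_card_filter_not (s := N) (fun x => ∀ k ∈ K, H.Adj x k)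
      have hNK : Disjoint N K := by
        rw [disjoint_left]
        exact fun x hx hxK => haK x hxK (mem_filter.1 hx).2
      by_cases hc : t ≤ #(N.filter fun x => ∀ k ∈ K, H.Adj x k)
      · exact hexact ⟨_, ((filter_subset _ _).trans (filter_subset _ _)).trans hBW, K,
          hKB.trans hBW, hNK.mono_left (filter_subset _ _), hc, by omega,
          fun x hx => (mem_filter.1 hx).2⟩
      · obtain ⟨x, hx, k, hk, hxk⟩ := hH (N.filter fun x => ¬∀ k ∈ K, H.Adj x k) K
          (hNK.mono_left (filter_subset _ _)) (by omega) (by omega)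
        rw [mem_filter, hN, mem_filter] at hx
        exact (hdich x hx.1.1 hx.1.2).resolve_left hx.2 k hk hxk
    have hBK := card_sdiff_add_card_eq_card hKB
    rw [mem_union]
    rcases hdich b hb hab with h | h
    · refine Or.inr (mem_filter.2 ⟨hb, (card_le_card (t := B \ K) ?_).trans (by omega)⟩)
      intro y hy
      rw [mem_filter] at hy
      exact mem_sdiff.2 ⟨hy.1, fun hyK => hy.2 (h y hyK)⟩
    · refine Or.inl (mem_filter.2 ⟨hb, (card_le_card (t := B \ K) ?_).trans (by omega)⟩)
      intro y hy
      rw [mem_filter] at hy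
      exact mem_sdiff.2 ⟨hy.1, fun hyK => h y hyK hy.2⟩
  have hunion : #B < #(Bs ∪ Bd) + t := by
    have hsub : Bs ∪ Bd ⊆ B := union_subset (filter_subset _ _) (filter_subset _ _)
    have hU := card_sdiff_add_card_eq_card hsub
    by_contra! h
    obtain ⟨a, ha, b, hb, hab⟩ := hH (A \ A₂) (B \ (Bs ∪ Bd))
      (hAB.mono sdiff_subset sdiff_subset) (by omega) (by omega)
    rw [mem_sdiff] at hb
    exact hb.2 (hcover a ha b hb.1 hab)
  have hBscard : #Bs < 15 * t + 3 := by
    by_contra! h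
    obtain ⟨b, hb, hbd⟩ := hP.exists_large_degree hH (S := Bs) (d := 3 * t) (by omega)
    have hBsB : Bs ⊆ B := filter_subset _ _
    have := card_le_card (filter_subset_filter (H.Adj b) hBsB)
    have := (mem_filter.1 hb).2
    omega
  have := card_union_le Bs Bd
  refine ⟨Bd, (filter_subset _ _).trans hBW, by omega, fun x hx => ?_⟩
  exact (card_le_card (filter_subset_filter _ (filter_subset _ _))).trans (mem_filter.1 hx).2

/-- There are disjoint complete sets with at least `s` vertices each. -/
def HasCompletePair (G : SimpleGraph V) (s : ℝ) : Prop :=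
  ∃ A B : Finset V, Disjoint A B ∧ (∀ a ∈ A, ∀ b ∈ B, G.Adj a b) ∧ s ≤ #A ∧ s ≤ #B

/-- Some set `X` with at least `s` vertices induces maximum degree less than `ε|X|`. -/
def HasSparseSet (G : SimpleGraph V) (ε s : ℝ) : Prop :=
  ∃ X : Finset V, s ≤ #X ∧ ∀ v ∈ X, (#(X.filter (G.Adj v)) : ℝ) < ε * #X

lemma HasCompletePair.mono {G : SimpleGraph V} {s t : ℝ} (h : HasCompletePair G s) (hts : t ≤ s) :
    HasCompletePair G t := by
  obtain ⟨A, B, h₁, h₂, h₃, h₄⟩ := h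
  exact ⟨A, B, h₁, h₂, hts.trans h₃, hts.trans h₄⟩

lemma HasSparseSet.mono {G : SimpleGraph V} {ε s t : ℝ} (h : HasSparseSet G ε s) (hts : t ≤ s) :
    HasSparseSet G ε t := by
  obtain ⟨X, h₁, h₂⟩ := h
  exact ⟨X, hts.trans h₁, h₂⟩

lemma HasCompletePair.of_not_noAnticompletePair_compl {G : SimpleGraph V} {t : ℕ}
    (h : ¬NoAnticompletePair Gᶜ t) : HasCompletePair G t := by
  unfold NoAnticompletePair at h
  push Not at h
  obtain ⟨A, B, hAB, hA, hB, hadj⟩ := h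
  refine ⟨A, B, hAB, fun a ha b hb => ?_, by exact_mod_cast hA, by exact_mod_cast hB⟩
  by_contra hab
  exact hadj a ha b hb ((G.compl_adj a b).2 ⟨disjoint_iff_ne.1 hAB a ha b hb, hab⟩)

/-- The second set of a pair can be shrunk so that it is not larger than the first one. -/
lemma exists_sparse_pair_shrink {G : SimpleGraph V} {A B W : Finset V} (hA : A ⊆ W) (hB : B ⊆ W)
    (hAB : Disjoint A B) {s η : ℝ} (hη : 0 ≤ η) (hsA : s ≤ #A) (hsB : s ≤ #B)
    (hdeg : ∀ a ∈ A, (#(B.filter (G.Adj a)) : ℝ) ≤ η * s) :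
    ∃ A ⊆ W, ∃ B ⊆ W, Disjoint A B ∧ s ≤ #B ∧ #B ≤ #A ∧
      ∀ a ∈ A, (#(B.filter (G.Adj a)) : ℝ) ≤ η * #B := by
  obtain ⟨B', hB'B, hB'⟩ := exists_subset_card_eq (min_le_right #A #B)
  have hs : s ≤ #B' := by
    rw [hB', Nat.cast_min]
    exact le_min hsA hsB
  refine ⟨A, hA, B', hB'B.trans hB, hAB.mono_right hB'B, hs, hB' ▸ min_le_left _ _, ?_⟩
  intro a ha
  calc (#(B'.filter (G.Adj a)) : ℝ) ≤ #(B.filter (G.Adj a)) := by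
        exact_mod_cast card_le_card (filter_subset_filter _ hB'B)
    _ ≤ η * s := hdeg a ha
    _ ≤ η * #B' := by gcongr

lemma exists_sparse_pair {ε η : ℝ} (hε : 0 < ε) (hε1 : ε ≤ 1) (hη : 0 < η) (hη1 : η ≤ 1) :
    ∃ c : ℝ, 0 < c ∧ ∀ (V : Type) (G : SimpleGraph V), HouseFree G →
      ∀ W : Finset V, W.Nonempty →
        HasCompletePair G (c * #W) ∨ HasSparseSet G ε (c * #W) ∨
        ∃ A ⊆ W, ∃ B ⊆ W, Disjoint A B ∧ c * #W ≤ #B ∧ #B ≤ #A ∧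
          ∀ a ∈ A, (#(B.filter (G.Adj a)) : ℝ) ≤ η * #B := by
  obtain ⟨c, hc, hcε, hcε2, hcη⟩ :
      ∃ c : ℝ, 0 < c ∧ 8000 * c ≤ ε ∧ 50 * c ≤ ε * ε ∧ 240 * c ≤ η * ε := by
    refine ⟨ε * ε * η / 8000, by positivity, ?_, ?_, ?_⟩ <;>
      nlinarith [mul_pos hε hη, mul_pos hε hε, mul_nonneg hε.le (sub_nonneg.2 hε1),
        mul_nonneg hε.le (sub_nonneg.2 hη1), mul_nonneg (mul_pos hε hε).le (sub_nonneg.2 hη1),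
        mul_nonneg (mul_pos hε hη).le (sub_nonneg.2 hε1)]
  refine ⟨c, hc, fun V G hG W hW => ?_⟩
  set n : ℝ := (#W : ℝ) with hn
  have hn1 : 1 ≤ n := by
    rw [hn]
    exact_mod_cast hW.card_pos
  rcases le_or_gt (c * n) 1 with hsmall | hlarge
  · obtain ⟨w, -⟩ := hW
    refine Or.inr (Or.inl ⟨{w}, by simpa using hsmall, fun v hv => ?_⟩)
    obtain rfl := mem_singleton.1 hv
    simpa [filter_singleton] using hε
  have hcεn : 8000 * (c * n) ≤ ε * n := by nlinarith
  have hcε2n : 50 * (c * n) ≤ ε * (ε * n) := by nlinarith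
  have hcηn : 240 * (c * n) ≤ η * (ε * n) := by nlinarith
  have hεn : ε * n ≤ n := by nlinarith
  set t := ⌈c * n⌉₊
  have htle : c * n ≤ t := Nat.le_ceil _
  have hlet : (t : ℝ) ≤ 2 * (c * n) := by
    have := Nat.ceil_lt_add_one (a := c * n) (by positivity)
    linarith
  set p := ⌊ε * n / 2⌋₊
  have hple : (p : ℝ) ≤ ε * n / 2 := Nat.floor_le (by positivity)
  have hlep : ε * n / 4 ≤ p := by
    have := Nat.lt_floor_add_one (ε * n / 2)
    linarith
  -- naming the complement keeps its own decidability instance out of the filters below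
  obtain ⟨H, hHG⟩ : ∃ H, H = Gᶜ := ⟨_, rfl⟩
  have hadj : ∀ {x y}, H.Adj x y → ¬G.Adj x y := fun {x y} h => ((G.compl_adj x y).1 (hHG ▸ h)).2
  have hP : NoInducedP5 H := hHG ▸ hG.noInducedP5_compl
  by_cases hpair : NoAnticompletePair H t
  swap
  · rw [hHG] at hpair
    exact Or.inl ((HasCompletePair.of_not_noAnticompletePair_compl hpair).mono htle)
  refine Or.inr ?_
  have hG_le : ∀ (x : V) (Y : Finset V),
      #(Y.filter (G.Adj x)) ≤ #(Y.filter fun y => x ≠ y ∧ ¬H.Adj x y) := fun x Y => by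
    exact card_le_card (monotone_filter_right _ fun y _ hy => ⟨hy.ne, fun h => hadj h hy⟩)
  have hG_le' : ∀ (x : V) (Y : Finset V),
      #(Y.filter (G.Adj x)) ≤ #(Y.filter fun y => ¬H.Adj x y) := fun x Y =>
    (hG_le x Y).trans (card_le_card (monotone_filter_right _ fun y _ hy => hy.2))
  rcases hP.exists_dense_set_or_pair hpair (p := p) (W := W)
      (Nat.ceil_pos.2 (by positivity)) (by rify; linarith) (by rify; linarith) with
    ⟨X, hXW, hX, hdeg⟩ | ⟨X, hXW, hX, hdeg⟩ | ⟨A, hA, B, hB, hAB, hcA, hcB, hdeg⟩ |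
      ⟨A, hA, B, hB, hAB, hcA, hcB, hdeg⟩
  · have hX' : n ≤ 2 * (#X : ℝ) := by
      rw [hn]
      exact_mod_cast hX
    refine Or.inl ⟨X, by linarith, fun v hv => ?_⟩
    have h1 : (#(X.filter (G.Adj v)) : ℝ) < p := by
      exact_mod_cast ((card_le_card (filter_subset_filter _ hXW)).trans (hG_le v W)).trans_lt
        (hdeg v hv)
    nlinarith
  · have hX' : (p : ℝ) ≤ 2 * #X := by exact_mod_cast hX
    refine Or.inl ⟨X, by linarith, fun v hv => ?_⟩
    have h1 : (#(X.filter (G.Adj v)) : ℝ) ≤ 3 * t := by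
      exact_mod_cast (hG_le' v X).trans (hdeg v hv)
    nlinarith
  · have hcA' : n ≤ 40 * (#A : ℝ) := by
      rw [hn]
      exact_mod_cast hcA
    have hcB' : (p : ℝ) ≤ #B := by exact_mod_cast hcB
    obtain ⟨A', hA', B', hB', h₁, h₂, h₃⟩ := exists_sparse_pair_shrink (G := G) (s := ε * n / 40)
      hA hB hAB hη.le (by linarith) (by linarith) fun a ha => by
        have h1 : (#(B.filter (G.Adj a)) : ℝ) ≤ 3 * t := by
          exact_mod_cast (hG_le' a B).trans (hdeg a ha)
        linarith
    exact Or.inr ⟨A', hA', B', hB', h₁, by linarith, h₃⟩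
  · have hcA' : (t : ℝ) ≤ #A := by exact_mod_cast hcA
    have hcB' : (t : ℝ) ≤ #B := by exact_mod_cast hcB
    refine Or.inr (exists_sparse_pair_shrink hA hB hAB hη.le (by linarith) (by linarith) ?_)
    intro a ha
    rw [filter_false_of_mem fun b hb => hadj (hdeg a ha b hb)]
    simp only [card_empty, Nat.cast_zero]
    positivity

lemma sum_card_filter_adj_union_le (G : SimpleGraph V) {X A : Finset V} (h : Disjoint X A) :
    ∑ x ∈ X ∪ A, #((X ∪ A).filter (G.Adj x)) ≤
      ∑ x ∈ X, #(X.filter (G.Adj x)) + #A * #A + 2 * ∑ a ∈ A, #(X.filter (G.Adj a)) := by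
  have hsplit : ∀ x, #((X ∪ A).filter (G.Adj x)) =
      #(X.filter (G.Adj x)) + #(A.filter (G.Adj x)) := fun x => by
    rw [filter_union, card_union_of_disjoint (disjoint_filter_filter h)]
  have hcomm : ∑ x ∈ X, #(A.filter (G.Adj x)) = ∑ a ∈ A, #(X.filter (G.Adj a)) := by
    simp only [card_filter]
    rw [sum_comm]
    simp only [G.adj_comm]
  have hA : ∑ a ∈ A, #(A.filter (G.Adj a)) ≤ #A * #A :=
    (sum_le_card_nsmul _ _ _ fun a _ => card_filter_le _ _).trans_eq (smul_eq_mul _ _)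
  simp only [hsplit]
  rw [sum_union h, sum_add_distrib, sum_add_distrib, hcomm]
  omega

/-- Iterating the pair lemma yields large sets that look like `k` sparsely joined pieces of
equal size `m`. -/
lemma exists_low_density {ε : ℝ} (hε : 0 < ε) (hε1 : ε ≤ 1) (k : ℕ) :
    ∃ δ : ℝ, 0 < δ ∧ δ ≤ 1 ∧ ∀ (V : Type) (G : SimpleGraph V), HouseFree G →
      ∀ W : Finset V, W.Nonempty →
        HasCompletePair G (δ * #W) ∨ HasSparseSet G ε (δ * #W) ∨
        ∃ X ⊆ W, ∃ m : ℕ, δ * #W ≤ m ∧ m ≤ #W ∧ #X = k * m ∧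
          ∑ x ∈ X, #(X.filter (G.Adj x)) ≤ 2 * k * m ^ 2 := by
  induction k with
  | zero =>
    exact ⟨1, one_pos, le_rfl, fun V G _ W _ =>
      Or.inr (Or.inr ⟨∅, empty_subset _, #W, by simp, le_rfl, by simp, by simp⟩)⟩
  | succ k ih =>
    obtain ⟨δ, hδ, hδ1, hk⟩ := ih
    obtain ⟨c, hc, hpair⟩ := exists_sparse_pair hε hε1 (half_pos hδ) (by linarith)
    refine ⟨min 1 (δ * c), lt_min one_pos (mul_pos hδ hc), min_le_left _ _, ?_⟩
    intro V G hG W hW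
    have hWpos : (0 : ℝ) < #W := by exact_mod_cast hW.card_pos
    have hle : min 1 (δ * c) * (#W : ℝ) ≤ δ * (c * #W) := by
      rw [← mul_assoc]
      gcongr
      exact min_le_right _ _
    have hle' : δ * (c * #W) ≤ c * #W := mul_le_of_le_one_left (by positivity) hδ1
    rcases hpair V G hG W hW with h | h | ⟨A, hA, B, hB, hAB, hcB, hBA, hdeg⟩
    · exact Or.inl (h.mono (hle.trans hle'))
    · exact Or.inr (Or.inl (h.mono (hle.trans hle')))
    have hBne : B.Nonempty := by
      rw [← card_pos]
      exact_mod_cast (mul_pos hc hWpos).trans_le hcB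
    have hle'' : min 1 (δ * c) * (#W : ℝ) ≤ δ * #B := hle.trans (by gcongr)
    rcases hk V G hG B hBne with h | h | ⟨X, hX, m, hδm, hmB, hXcard, hXsum⟩
    · exact Or.inl (h.mono hle'')
    · exact Or.inr (Or.inl (h.mono hle''))
    obtain ⟨A', hA', hA'card⟩ := exists_subset_card_eq (hmB.trans hBA)
    have hXA : Disjoint X A' := (hAB.mono hA' hX).symm
    refine Or.inr (Or.inr ⟨X ∪ A', union_subset (hX.trans hB) (hA'.trans hA), m,
      hle''.trans hδm, hmB.trans (card_le_card hB), ?_, ?_⟩)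
    · rw [card_union_of_disjoint hXA, hXcard, hA'card]
      ring
    · have hdeg' : ∀ a ∈ A', 2 * #(X.filter (G.Adj a)) ≤ m := fun a ha => by
        have h1 : (#(X.filter (G.Adj a)) : ℝ) ≤ #(B.filter (G.Adj a)) := by
          exact_mod_cast card_le_card (filter_subset_filter _ hX)
        have h2 := hdeg a (hA' ha)
        rify
        linarith
      have hsum : 2 * ∑ a ∈ A', #(X.filter (G.Adj a)) ≤ m * m := by
        rw [mul_sum]
        refine (sum_le_card_nsmul _ _ _ hdeg').trans_eq ?_
        rw [hA'card, smul_eq_mul]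
      have := sum_card_filter_adj_union_le G hXA
      rw [hA'card] at this
      nlinarith

/-- Deleting the vertices of large degree from a set of small average degree leaves a set of
small maximum degree. -/
lemma hasSparseSet_of_sum_le {G : SimpleGraph V} {X : Finset V} (hX : X.Nonempty) {ε : ℝ}
    (hε : 0 < ε)
    (h : ((∑ x ∈ X, #(X.filter (G.Adj x)) : ℕ) : ℝ) ≤ ε / 4 * (#X : ℝ) ^ 2) :
    HasSparseSet G ε (#X / 2) := by
  have hXpos : (0 : ℝ) < #X := by exact_mod_cast hX.card_pos
  set L := X.filter fun x => (#(X.filter (G.Adj x)) : ℝ) < ε / 2 * #X with hL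
  have hLX : L ⊆ X := filter_subset _ _
  have hsdiff : #(X \ L) * (ε / 2 * #X) ≤ ε / 4 * (#X : ℝ) ^ 2 := by
    calc (#(X \ L) : ℝ) * (ε / 2 * #X) = ∑ x ∈ X \ L, ε / 2 * (#X : ℝ) := by
          rw [sum_const, nsmul_eq_mul]
      _ ≤ ∑ x ∈ X \ L, (#(X.filter (G.Adj x)) : ℝ) := by
          refine sum_le_sum fun x hx => ?_
          rw [mem_sdiff, hL, mem_filter] at hx
          by_contra! hlt
          exact hx.2 ⟨hx.1, hlt⟩
      _ ≤ ∑ x ∈ X, (#(X.filter (G.Adj x)) : ℝ) :=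
          sum_le_sum_of_subset_of_nonneg sdiff_subset fun _ _ _ => by positivity
      _ ≤ _ := by exact_mod_cast h
  have hcard : (#(X \ L) : ℝ) ≤ #X / 2 := by
    refine le_of_mul_le_mul_right (hsdiff.trans_eq ?_) (by positivity : 0 < ε / 2 * (#X : ℝ))
    ring
  have hadd : (#(X \ L) : ℝ) + #L = #X := by exact_mod_cast card_sdiff_add_card_eq_card hLX
  refine ⟨L, by linarith, fun v hv => ?_⟩
  have h1 : (#(L.filter (G.Adj v)) : ℝ) ≤ #(X.filter (G.Adj v)) := by
    exact_mod_cast card_le_card (filter_subset_filter _ hLX)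
  have h2 := (mem_filter.1 hv).2
  nlinarith

lemma HouseFree.exists_completePair_or_sparseSet {ε : ℝ} (hε : 0 < ε) (hε1 : ε ≤ 1) :
    ∃ δ : ℝ, 0 < δ ∧ ∀ (V : Type) (G : SimpleGraph V), HouseFree G →
      ∀ W : Finset V, W.Nonempty → HasCompletePair G (δ * #W) ∨ HasSparseSet G ε (δ * #W) := by
  obtain ⟨k, hk⟩ := exists_nat_gt (8 / ε)
  have hkpos : (0 : ℝ) < k := (by positivity : 0 < 8 / ε).trans hk
  have hk1 : (1 : ℝ) ≤ k := by
    have : 0 < k := by exact_mod_cast hkpos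
    exact_mod_cast this
  have hkε : 8 ≤ ε * k := by
    rw [div_lt_iff₀ hε] at hk
    linarith
  obtain ⟨δ, hδ, -, h⟩ := exists_low_density hε hε1 k
  refine ⟨δ / 2, half_pos hδ, fun V G hG W hW => ?_⟩
  have hWpos : (0 : ℝ) < #W := by exact_mod_cast hW.card_pos
  have hδW := mul_pos hδ hWpos
  rcases h V G hG W hW with h | h | ⟨X, -, m, hm, -, hX, hsum⟩
  · exact Or.inl (h.mono (by linarith))
  · exact Or.inr (h.mono (by linarith))
  have hXcard : (#X : ℝ) = k * m := by exact_mod_cast hX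
  have hmX : (m : ℝ) ≤ #X := by
    rw [hXcard]
    exact le_mul_of_one_le_left (by positivity) hk1
  refine Or.inr ((hasSparseSet_of_sum_le (X := X) (card_pos.1 ?_) hε ?_).mono (by linarith))
  · have : (0 : ℝ) < #X := by linarith
    exact_mod_cast this
  · calc ((∑ x ∈ X, #(X.filter (G.Adj x)) : ℕ) : ℝ) ≤ 2 * k * (m : ℝ) ^ 2 := by exact_mod_cast hsum
      _ ≤ ε * k / 4 * k * (m : ℝ) ^ 2 := by
          gcongr
          linarith
      _ = ε / 4 * (#X : ℝ) ^ 2 := by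
          rw [hXcard]
          ring

end

theorem statement_17 (ε : ℝ) (hε : 0 < ε) :
    ∃ δ : ℝ, 0 < δ ∧ ∀ (V : Type) [Fintype V] (G : SimpleGraph V),
      HouseFree G → 1 < Fintype.card V →
      (∃ A B : Set V, Disjoint A B ∧ CompleteTo G A B ∧
        ε * δ * (Fintype.card V : ℝ) ≤ (A.ncard : ℝ) ∧
        ε * δ * (Fintype.card V : ℝ) ≤ (B.ncard : ℝ)) ∨
      (∃ X : Set V, δ * (Fintype.card V : ℝ) ≤ (X.ncard : ℝ) ∧
        ∀ v ∈ X, ((G.neighborSet v ∩ X).ncard : ℝ) < ε * (X.ncard : ℝ)) := by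
  obtain ⟨δ, hδ, h⟩ :=
    HouseFree.exists_completePair_or_sparseSet (lt_min hε one_pos) (min_le_right ε 1)
  refine ⟨min δ (δ / ε), lt_min hδ (div_pos hδ hε), fun V _ G hG hV => ?_⟩
  have hV' : (univ : Finset V).Nonempty := by
    rw [← card_pos, card_univ]
    omega
  rcases h V G hG univ hV' with ⟨A, B, hAB, hadj, hA, hB⟩ | ⟨X, hX, hdeg⟩
  · have hle : ε * min δ (δ / ε) * (Fintype.card V : ℝ) ≤ δ * #(univ : Finset V) := by
      rw [card_univ]
      gcongr
      calc ε * min δ (δ / ε) ≤ ε * (δ / ε) := by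
            gcongr
            exact min_le_right _ _
        _ = δ := by field_simp
    refine Or.inl ⟨A, B, by exact_mod_cast hAB, fun a ha b hb => hadj a ha b hb, ?_, ?_⟩ <;>
      rw [Set.ncard_coe_finset]
    · exact hle.trans hA
    · exact hle.trans hB
  · refine Or.inr ⟨X, ?_, fun v hv => ?_⟩ <;> rw [Set.ncard_coe_finset]
    · refine le_trans ?_ hX
      rw [card_univ]
      gcongr
      exact min_le_left _ _
    · classical
      have hset : G.neighborSet v ∩ (X : Set V) = (X.filter (G.Adj v) : Finset V) := by
        ext w
        simp [and_comm]
      rw [hset, Set.ncard_coe_finset]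
      refine lt_of_lt_of_le ?_ (mul_le_mul_of_nonneg_right (min_le_left ε 1) (Nat.cast_nonneg _))
      convert hdeg v hv

end EHhat
end
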